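/- Let 2 ≤ p < ∞, let c_v > 0, and let A > 1. There exists a constant C > 0, depending only on A, p and c_v, with the following property. Let X be a real Banach space that is uniformly convex of power type p with constant c_v, let Γ ⊆ X be a rectifiable curve, let E ⊆ Γ be nonempty, and let G be a partial multiresolution family for E with inflation factor A. Then S_{E,p}(G) := diam E + Σ_{Q ∈ G} β_E(Q)^p·diam Q ≤ C·H^1(Γ). -/

import Mathlib

open Metric MeasureTheory Set Bornology
open scoped ENNReal NNReal Classical

universe u

noncomputable section

/-- The affine line through `a` with direction `v`. -/
def lineThrough {X : Type u} [AddCommGroup X] [Module ℝ X] (a v : X) : Set X :=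
  {y | ∃ t : ℝ, y = a + t • v}

/-- The Jones beta number of `E` in the window `Q`:
`β_E(Q) = inf_L sup_{x ∈ E ∩ Q} dist(x,L)/diam Q`, with value `0` if `E ∩ Q = ∅`. -/
def jonesBeta {X : Type u} [NormedAddCommGroup X] [NormedSpace ℝ X] (E Q : Set X) : ℝ :=
  if E ∩ Q = ∅ then 0
  else sInf {r : ℝ | ∃ a v : X, v ≠ 0 ∧
    r = sSup ((fun x => infDist x (lineThrough a v) / Metric.diam Q) '' (E ∩ Q))}

/-- `net` encodes a partial multiresolution family for `E`: a nested family of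
`2^{-k}`-separated subsets of `E`. -/
def IsPartialMultiresolution {X : Type u} [NormedAddCommGroup X]
    (E : Set X) (net : ℤ → Set X) : Prop :=
  (∀ k, net k ⊆ E) ∧ (∀ k, net k ⊆ net (k + 1)) ∧
    (∀ k : ℤ, ∀ x ∈ net k, ∀ y ∈ net k, x ≠ y → (2 : ℝ) ^ (-k) ≤ dist x y)

/-- `net` encodes a multiresolution family for `E`: a nested family of `2^{-k}`-nets for `E`. -/
def IsMultiresolution {X : Type u} [NormedAddCommGroup X]
    (E : Set X) (net : ℤ → Set X) : Prop :=
  IsPartialMultiresolution E net ∧ ∀ k : ℤ, ∀ e ∈ E, ∃ x ∈ net k, dist e x ≤ (2 : ℝ) ^ (-k)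

/-- The sum `Σ_{Q ∈ G} β_E(Q)^p · diam Q` over the (partial) multiresolution family
`G = {B(x, A·2^{-k}) : x ∈ net k, k ∈ ℤ}` with inflation factor `A`. -/
def betaSum {X : Type u} [NormedAddCommGroup X] [NormedSpace ℝ X]
    (E : Set X) (net : ℤ → Set X) (A p : ℝ) : ℝ≥0∞ :=
  ∑' (k : ℤ), ∑' (x : net k),
    ENNReal.ofReal (jonesBeta E (closedBall (x : X) (A * (2 : ℝ) ^ (-k))) ^ p *
      Metric.diam (closedBall (x : X) (A * (2 : ℝ) ^ (-k))))

/-- `S_{E,p}(G) = diam E + Σ_{Q ∈ G} β_E(Q)^p · diam Q`. -/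
def SEp {X : Type u} [NormedAddCommGroup X] [NormedSpace ℝ X]
    (E : Set X) (net : ℤ → Set X) (A p : ℝ) : ℝ≥0∞ :=
  ENNReal.ofReal (Metric.diam E) + betaSum E net A p

/-- `Γ` is a rectifiable curve: the image of a continuous map `[0,1] → X` with
finite one-dimensional Hausdorff measure. -/
def IsRectifiableCurve {X : Type u} [NormedAddCommGroup X]
    [MeasurableSpace X] [BorelSpace X] (Γ : Set X) : Prop :=
  (∃ f : ℝ → X, ContinuousOn f (Set.Icc (0 : ℝ) 1) ∧ Γ = f '' Set.Icc (0 : ℝ) 1) ∧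
    μH[1] Γ < ⊤

section Covering

variable {M : Type*} [MetricSpace M]

lemma Icc_subset_dist_image_of_isPreconnected {Γ : Set M} (hΓ : IsPreconnected Γ) {x y : M}
    (hx : x ∈ Γ) (hy : y ∈ Γ) {l : ℝ} (hl : l ≤ dist x y) :
    Icc 0 l ⊆ (fun z => dist x z) '' (Γ ∩ closedBall x l) := by
  intro t ht
  have h := hΓ.intermediate_value hx hy (f := fun z => dist x z) (by fun_prop)
  obtain ⟨z, hz, hzt⟩ := h (show t ∈ Icc (dist x x) (dist x y) from
    ⟨by simpa using ht.1, ht.2.trans hl⟩)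
  refine ⟨z, ⟨hz, ?_⟩, hzt⟩
  rw [mem_closedBall, dist_comm]
  exact hzt.le.trans ht.2

/-- A finite cover of the part of a connected set in a ball has total diameter at least
the radius. -/
lemma le_sum_diam_of_isPreconnected {Γ : Set M} (hΓ : IsPreconnected Γ) {x y : M}
    (hx : x ∈ Γ) (hy : y ∈ Γ) {l : ℝ} (hl : l ≤ dist x y) (𝒱 : Finset (Set M))
    (hb : ∀ U ∈ 𝒱, IsBounded U) (hcov : Γ ∩ closedBall x l ⊆ ⋃ U ∈ 𝒱, U) :
    l ≤ ∑ U ∈ 𝒱, diam U := by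
  have hsub : Icc 0 l ⊆ ⋃ U ∈ 𝒱, (fun z => dist x z) '' U := by
    refine (Icc_subset_dist_image_of_isPreconnected hΓ hx hy hl).trans ?_
    rintro _ ⟨z, hz, rfl⟩
    obtain ⟨U, hU, hzU⟩ := mem_iUnion₂.1 (hcov hz)
    exact mem_iUnion₂.2 ⟨U, hU, z, hzU, rfl⟩
  have h1 : ENNReal.ofReal l ≤ ENNReal.ofReal (∑ U ∈ 𝒱, diam U) := by
    calc ENNReal.ofReal l = volume (Icc 0 l) := by simp
      _ ≤ volume (⋃ U ∈ 𝒱, (fun z => dist x z) '' U) := measure_mono hsub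
      _ ≤ ∑ U ∈ 𝒱, volume ((fun z => dist x z) '' U) := measure_biUnion_finset_le _ _
      _ ≤ ∑ U ∈ 𝒱, ENNReal.ofReal (diam U) := by
        refine Finset.sum_le_sum fun U hU => ?_
        refine (Real.volume_le_diam _).trans ?_
        refine ((LipschitzWith.dist_right x).ediam_image_le U).trans ?_
        rw [ENNReal.coe_one, one_mul, diam, ENNReal.ofReal_toReal (hb U hU).ediam_ne_top]
      _ = ENNReal.ofReal (∑ U ∈ 𝒱, diam U) :=
        (ENNReal.ofReal_sum_of_nonneg fun U _ => diam_nonneg).symm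
  exact (ENNReal.ofReal_le_ofReal_iff (Finset.sum_nonneg fun U _ => diam_nonneg)).1 h1

lemma le_hausdorffMeasure_inter_closedBall [MeasurableSpace M] [BorelSpace M]
    {Γ : Set M} (hΓ : IsPreconnected Γ) {x y : M}
    (hx : x ∈ Γ) (hy : y ∈ Γ) {l : ℝ} (hl : l ≤ dist x y) :
    ENNReal.ofReal l ≤ μH[1] (Γ ∩ closedBall x l) := by
  calc ENNReal.ofReal l = volume (Icc 0 l) := by simp
    _ ≤ volume ((fun z => dist x z) '' (Γ ∩ closedBall x l)) :=
      measure_mono (Icc_subset_dist_image_of_isPreconnected hΓ hx hy hl)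
    _ = μH[1] ((fun z => dist x z) '' (Γ ∩ closedBall x l)) := by rw [hausdorffMeasure_real]
    _ ≤ μH[1] (Γ ∩ closedBall x l) := by
      simpa using (LipschitzWith.dist_right x).hausdorffMeasure_image_le zero_le_one _

end Covering

section Parametrization

variable {M : Type*} [MetricSpace M]

lemma card_mul_le_hausdorffMeasure [MeasurableSpace M] [BorelSpace M] {Γ : Set M}
    (hΓ : IsPreconnected Γ) (hc : IsCompact Γ) (hfin : μH[1] Γ < ⊤) {δ : ℝ} (hδ : 0 < δ)
    (hfar : ∀ x ∈ Γ, ∃ y ∈ Γ, δ ≤ dist x y) (V : Finset M) (hV : (V : Set M) ⊆ Γ)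
    (hsep : ∀ v ∈ V, ∀ w ∈ V, v ≠ w → 2 * δ < dist v w) :
    V.card * δ ≤ (μH[1] Γ).toReal := by
  have h1 : ∑ _v ∈ V, ENNReal.ofReal δ ≤ μH[1] Γ := by
    calc ∑ _v ∈ V, ENNReal.ofReal δ ≤ ∑ v ∈ V, μH[1] (Γ ∩ closedBall v δ) := by
          refine Finset.sum_le_sum fun v hv => ?_
          obtain ⟨y, hy, hvy⟩ := hfar v (hV hv)
          exact le_hausdorffMeasure_inter_closedBall hΓ (hV hv) hy hvy
      _ = μH[1] (⋃ v ∈ V, Γ ∩ closedBall v δ) := by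
          refine (measure_biUnion_finset ?_ ?_).symm
          · intro v hv w hw hvw
            refine Set.disjoint_left.2 fun z hz hz' => ?_
            have := hsep v hv w hw hvw
            have h1 := mem_closedBall.1 hz.2
            have h2 := mem_closedBall.1 hz'.2
            have h3 := dist_triangle_left v w z
            linarith
          · exact fun v _ => hc.isClosed.measurableSet.inter isClosed_closedBall.measurableSet
      _ ≤ μH[1] Γ := measure_mono (iUnion₂_subset fun v _ => inter_subset_left)
  have h2 := ENNReal.toReal_mono hfin.ne h1
  rw [Finset.sum_const, nsmul_eq_mul, ENNReal.toReal_mul, ENNReal.toReal_ofReal hδ.le] at h2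
  simpa using h2

lemma exists_separated_net [MeasurableSpace M] [BorelSpace M] {Γ : Set M}
    (hΓ : IsPreconnected Γ) (hc : IsCompact Γ) (hfin : μH[1] Γ < ⊤) {δ : ℝ} (hδ : 0 < δ)
    (hfar : ∀ x ∈ Γ, ∃ y ∈ Γ, δ ≤ dist x y) :
    ∃ V : Finset M, (V : Set M) ⊆ Γ ∧ (∀ x ∈ Γ, ∃ v ∈ V, dist x v ≤ 2 * δ) ∧
      V.card * δ ≤ (μH[1] Γ).toReal := by
  let T : Set ℕ := {n | ∃ V : Finset M, V.card = n ∧ (V : Set M) ⊆ Γ ∧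
    ∀ v ∈ V, ∀ w ∈ V, v ≠ w → 2 * δ < dist v w}
  have hbdd : BddAbove T := by
    refine ⟨⌊(μH[1] Γ).toReal / δ⌋₊, ?_⟩
    rintro n ⟨V, rfl, hV, hsep⟩
    refine Nat.le_floor ?_
    rw [le_div_iff₀ hδ]
    exact card_mul_le_hausdorffMeasure hΓ hc hfin hδ hfar V hV hsep
  obtain ⟨V, hcard, hV, hsep⟩ : sSup T ∈ T :=
    Nat.sSup_mem ⟨0, ∅, by simp, by simp, by simp⟩ hbdd
  refine ⟨V, hV, fun x hx => ?_, card_mul_le_hausdorffMeasure hΓ hc hfin hδ hfar V hV hsep⟩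
  by_contra! hcon
  have hxV : x ∉ V := fun h => by
    have := hcon x h
    rw [dist_self] at this
    linarith
  have hmem : V.card + 1 ∈ T := by
    refine ⟨insert x V, Finset.card_insert_of_notMem hxV, ?_, ?_⟩
    · rw [Finset.coe_insert]
      exact insert_subset hx hV
    · intro v hv w hw hvw
      rcases Finset.mem_insert.1 hv with hvx | hvV <;>
        rcases Finset.mem_insert.1 hw with hwx | hwV
      · exact absurd (hvx.trans hwx.symm) hvw
      · exact hvx ▸ hcon w hwV
      · rw [dist_comm]
        exact hwx ▸ hcon v hvV
      · exact hsep v hvV w hwV hvw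
  have := le_csSup hbdd hmem
  omega

/-- A connected set near a finite net is traversed by a walk through the net with short steps
visiting every edge of a spanning tree twice. -/
lemma exists_walk {Γ : Set M} (hΓ : IsPreconnected Γ) {δ : ℝ} (V : Finset M)
    (hV : (V : Set M) ⊆ Γ) (hnet : ∀ x ∈ Γ, ∃ v ∈ V, dist x v ≤ δ) :
    ∀ m : ℕ, m + 1 ≤ V.card → ∃ (S : Finset M) (g : ℕ → M), S ⊆ V ∧ S.card = m + 1 ∧
      (∀ i ≤ 2 * m, g i ∈ S) ∧ (∀ v ∈ S, ∃ i ≤ 2 * m, g i = v) ∧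
      ∀ i < 2 * m, dist (g i) (g (i + 1)) ≤ 2 * δ := by
  intro m
  induction m with
  | zero =>
    intro hm
    obtain ⟨v, hv⟩ : V.Nonempty := Finset.card_pos.1 (by omega)
    exact ⟨{v}, fun _ => v, by simpa using hv, by simp, by simp, by simp, by simp⟩
  | succ m ih =>
    intro hm
    obtain ⟨S, g, hSV, hcard, hgS, hSg, hstep⟩ := ih (by omega)
    obtain ⟨s, hs, w, hwV, hwS, hsw⟩ :
        ∃ s ∈ S, ∃ w ∈ V, w ∉ S ∧ dist s w ≤ 2 * δ := by
      have hSne : S.Nonempty := Finset.card_pos.1 (by omega)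
      obtain ⟨w₀, hw₀V, hw₀S⟩ : ∃ w ∈ V, w ∉ S := by
        by_contra! hcon
        have := Finset.card_le_card (show V ⊆ S from hcon)
        omega
      have hclosed : ∀ T : Finset M, IsClosed (⋃ v ∈ T, closedBall v δ) := fun T =>
        T.finite_toSet.isClosed_biUnion fun v _ => isClosed_closedBall
      obtain ⟨v₀, hv₀⟩ := hSne
      have hδ0 : 0 ≤ δ := by
        obtain ⟨v, _, hv⟩ := hnet v₀ (hV (hSV hv₀))
        exact dist_nonneg.trans hv
      obtain ⟨z, _, hz1, hz2⟩ := (isPreconnected_closed_iff.1 hΓ) (⋃ v ∈ S, closedBall v δ)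
        (⋃ v ∈ V \ S, closedBall v δ) (hclosed S) (hclosed (V \ S))
        (by
          intro x hx
          obtain ⟨v, hv, hxv⟩ := hnet x hx
          by_cases hvS : v ∈ S
          · exact Or.inl (mem_iUnion₂.2 ⟨v, hvS, hxv⟩)
          · exact Or.inr (mem_iUnion₂.2 ⟨v, Finset.mem_sdiff.2 ⟨hv, hvS⟩, hxv⟩))
        ⟨v₀, hV (hSV hv₀), mem_iUnion₂.2 ⟨v₀, hv₀, mem_closedBall_self hδ0⟩⟩
        ⟨w₀, hV hw₀V, mem_iUnion₂.2
          ⟨w₀, Finset.mem_sdiff.2 ⟨hw₀V, hw₀S⟩, mem_closedBall_self hδ0⟩⟩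
      obtain ⟨s, hs, hzs⟩ := mem_iUnion₂.1 hz1
      obtain ⟨w, hw, hzw⟩ := mem_iUnion₂.1 hz2
      refine ⟨s, hs, w, (Finset.mem_sdiff.1 hw).1, (Finset.mem_sdiff.1 hw).2, ?_⟩
      have := dist_triangle_left s w z
      rw [mem_closedBall] at hzs hzw
      linarith
    obtain ⟨j, hj, rfl⟩ := hSg s hs
    refine ⟨insert w S, fun i => if i ≤ j then g i else if i = j + 1 then w else g (i - 2),
      Finset.insert_subset hwV hSV, by rw [Finset.card_insert_of_notMem hwS, hcard], ?_, ?_, ?_⟩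
    · intro i hi
      dsimp only
      split_ifs with h1 h2
      · exact Finset.mem_insert_of_mem (hgS i (by omega))
      · exact Finset.mem_insert_self _ _
      · exact Finset.mem_insert_of_mem (hgS (i - 2) (by omega))
    · intro v hv
      rcases Finset.mem_insert.1 hv with rfl | hv
      · exact ⟨j + 1, by omega, by simp⟩
      · obtain ⟨i, hi, rfl⟩ := hSg v hv
        by_cases hij : i ≤ j
        · exact ⟨i, by omega, by simp [hij]⟩
        · exact ⟨i + 2, by omega, by
            simp only [show ¬ (i + 2 ≤ j) by omega, show ¬ (i + 2 = j + 1) by omega, if_false,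
              Nat.add_sub_cancel]⟩
    · intro i hi
      dsimp only
      rcases lt_trichotomy i j with h | rfl | h
      · rw [if_pos h.le, if_pos (by omega)]
        exact hstep i (by omega)
      · rw [if_pos le_rfl, if_neg (by omega), if_pos rfl]
        exact hsw
      · rw [if_neg (by omega : ¬ i ≤ j), if_neg (by omega : ¬ i + 1 ≤ j),
          if_neg (by omega : ¬ i + 1 = j + 1)]
        by_cases h' : i = j + 1
        · subst h'
          rw [if_pos rfl, dist_comm]
          exact hsw
        · rw [if_neg h']
          obtain ⟨k, rfl⟩ : ∃ k, i = k + 2 := ⟨i - 2, by omega⟩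
          simpa using hstep k (by omega)

lemma dist_le_mul_abs_sub_of_step {g : ℕ → M} {N : ℕ} {c : ℝ}
    (hstep : ∀ i < N, dist (g i) (g (i + 1)) ≤ c) {i j : ℕ} (hi : i ≤ N) (hj : j ≤ N) :
    dist (g i) (g j) ≤ c * |(i : ℝ) - j| := by
  wlog hij : i ≤ j generalizing i j
  · rw [dist_comm, abs_sub_comm]
    exact this hj hi (by omega)
  have h := dist_le_Ico_sum_of_dist_le hij (d := fun _ => c) (f := g)
    (fun {k} _ hk => hstep k (by omega))
  rw [Finset.sum_const, Nat.card_Ico, nsmul_eq_mul, Nat.cast_sub hij] at h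
  have h' : |(i : ℝ) - j| = j - i := by
    rw [abs_sub_comm, abs_of_nonneg (sub_nonneg.2 (by exact_mod_cast hij))]
  rw [h', mul_comm]
  exact h

/-- At every small scale `δ` a rectifiable continuum is traversed, up to errors of order `δ`,
with speed at most eight times its length. -/
lemma exists_approx_parametrization [MeasurableSpace M] [BorelSpace M] {Γ : Set M}
    (hΓ : IsPreconnected Γ) (hc : IsCompact Γ) (hne : Γ.Nonempty) (hfin : μH[1] Γ < ⊤)
    {δ : ℝ} (hδ : 0 < δ) (hfar : ∀ x ∈ Γ, ∃ y ∈ Γ, δ ≤ dist x y) :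
    ∃ f : ℝ → M, (∀ t ∈ Icc (0 : ℝ) 1, f t ∈ Γ) ∧
      (∀ s ∈ Icc (0 : ℝ) 1, ∀ t ∈ Icc (0 : ℝ) 1,
        dist (f s) (f t) ≤ 8 * (μH[1] Γ).toReal * |s - t| + 4 * δ) ∧
      ∀ x ∈ Γ, ∃ t ∈ Icc (0 : ℝ) 1, dist (f t) x ≤ 2 * δ := by
  obtain ⟨V, hV, hnet, hcard⟩ := exists_separated_net hΓ hc hfin hδ hfar
  obtain ⟨x₀, hx₀⟩ := hne
  obtain ⟨v₀, hv₀, _⟩ := hnet x₀ hx₀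
  have hpos : 0 < V.card := Finset.card_pos.2 ⟨v₀, hv₀⟩
  obtain ⟨S, g, hSV, hScard, hgS, hSg, hstep⟩ := exists_walk hΓ V hV hnet (V.card - 1) (by omega)
  obtain rfl : S = V := Finset.eq_of_subset_of_card_le hSV (by omega)
  set N := 2 * (S.card - 1) with hN
  have hfloor : ∀ t ∈ Icc (0 : ℝ) 1, ⌊t * N⌋₊ ≤ N := by
    intro t ht
    have : t * N ≤ N := mul_le_of_le_one_left (Nat.cast_nonneg _) ht.2
    exact (Nat.floor_mono this).trans (by simp)
  refine ⟨fun t => g ⌊t * N⌋₊, fun t ht => hV (hgS _ (hfloor t ht)), ?_, ?_⟩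
  · intro s hs t ht
    refine (dist_le_mul_abs_sub_of_step hstep (hfloor s hs) (hfloor t ht)).trans ?_
    have hs0 : 0 ≤ s * N := mul_nonneg hs.1 (Nat.cast_nonneg _)
    have ht0 : 0 ≤ t * N := mul_nonneg ht.1 (Nat.cast_nonneg _)
    have hab : |(⌊s * N⌋₊ : ℝ) - ⌊t * N⌋₊| ≤ |s - t| * N + 1 := by
      have e : |s - t| * N = |s * N - t * N| := by
        rw [← sub_mul, abs_mul, Nat.abs_cast]
      rw [e]
      have h1 := Nat.floor_le hs0
      have h2 := Nat.lt_floor_add_one (s * N)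
      have h3 := Nat.floor_le ht0
      have h4 := Nat.lt_floor_add_one (t * N)
      have h5 := le_abs_self (s * N - t * N)
      have h6 := neg_abs_le (s * N - t * N)
      rw [abs_le]
      constructor <;> linarith
    have hNδ : (N : ℝ) * δ ≤ 2 * (μH[1] Γ).toReal := by
      have : (N : ℝ) ≤ 2 * S.card := by exact_mod_cast (by omega : N ≤ 2 * S.card)
      nlinarith
    have h0 := abs_nonneg (s - t)
    nlinarith
  · intro x hx
    obtain ⟨v, hv, hxv⟩ := hnet x hx
    obtain ⟨i, hi, rfl⟩ := hSg v hv
    rcases Nat.eq_zero_or_pos N with h0 | h0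
    · refine ⟨0, by simp, ?_⟩
      have : i = 0 := by omega
      subst this
      simpa [dist_comm] using hxv
    · have hN0 : (0 : ℝ) < N := by exact_mod_cast h0
      refine ⟨i / N, ⟨by positivity, (div_le_one hN0).2 (by exact_mod_cast hi)⟩, ?_⟩
      dsimp only
      rw [div_mul_cancel₀ _ hN0.ne', Nat.floor_natCast, dist_comm]
      exact hxv

/-- A rectifiable continuum is a Lipschitz image of the unit interval, with Lipschitz constant
comparable to its length. -/
theorem exists_lipschitz_parametrization [MeasurableSpace M] [BorelSpace M] {Γ : Set M}
    (hΓ : IsPreconnected Γ) (hc : IsCompact Γ) (hnt : Γ.Nontrivial) (hfin : μH[1] Γ < ⊤) :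
    ∃ f : ℝ → M, f '' Icc 0 1 = Γ ∧ ∀ s ∈ Icc (0 : ℝ) 1, ∀ t ∈ Icc (0 : ℝ) 1,
      dist (f s) (f t) ≤ 8 * (μH[1] Γ).toReal * |s - t| := by
  set h := (μH[1] Γ).toReal
  obtain ⟨a, ha, b, hb, hab⟩ := hnt
  have hd : 0 < dist a b := dist_pos.2 hab
  let δ : ℕ → ℝ := fun n => dist a b / 2 * (1 / ((n : ℝ) + 1))
  have hδ0 : ∀ n, 0 < δ n := fun n => by positivity
  have hδlim : Filter.Tendsto δ Filter.atTop (nhds 0) := by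
    have := (tendsto_one_div_add_atTop_nhds_zero_nat (𝕜 := ℝ)).const_mul (dist a b / 2)
    rwa [mul_zero] at this
  have hfar : ∀ n, ∀ x ∈ Γ, ∃ y ∈ Γ, δ n ≤ dist x y := by
    intro n x hx
    have h1 : δ n ≤ dist a b / 2 := by
      refine mul_le_of_le_one_right (by positivity) ?_
      rw [div_le_one (by positivity)]
      linarith [(Nat.cast_nonneg n : (0 : ℝ) ≤ n)]
    by_contra! hcon
    have := hcon a ha
    have := hcon b hb
    have := dist_triangle_left a b x
    linarith
  choose f hfΓ hflip hfonto using fun n =>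
    exists_approx_parametrization hΓ hc ⟨a, ha⟩ hfin (hδ0 n) (hfar n)
  let U : Ultrafilter ℕ := Filter.hyperfilter ℕ
  have hU : (U : Filter ℕ) ≤ Filter.atTop := Nat.hyperfilter_le_atTop
  have hlim : ∀ t : ℝ, t ∈ Icc (0 : ℝ) 1 → ∃ x, x ∈ Γ ∧ Filter.Tendsto (fun n => f n t) U (nhds x) := by
    intro t ht
    exact hc.ultrafilter_le_nhds (U.map fun n => f n t) (by
      rw [Ultrafilter.coe_map, Filter.le_principal_iff]
      exact Filter.Eventually.of_forall (f := (U : Filter ℕ)) fun n => hfΓ n t ht)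
  have : Nonempty M := ⟨a⟩
  choose! F hFΓ hF using hlim
  have hδU : Filter.Tendsto δ U (nhds 0) := hδlim.mono_left hU
  refine ⟨F, ?_, ?_⟩
  · refine Subset.antisymm (image_subset_iff.2 hFΓ) fun x hx => ?_
    choose t ht htx using fun n => hfonto n x hx
    obtain ⟨t₀, ht₀, htlim⟩ := isCompact_Icc.ultrafilter_le_nhds (U.map t) (by
      rw [Ultrafilter.coe_map, Filter.le_principal_iff]
      exact Filter.Eventually.of_forall (f := (U : Filter ℕ)) ht)
    have htlim' : Filter.Tendsto t U (nhds t₀) := htlim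
    refine ⟨t₀, ht₀, tendsto_nhds_unique (hF t₀ ht₀) ?_⟩
    rw [tendsto_iff_dist_tendsto_zero]
    refine squeeze_zero (fun _ => dist_nonneg)
      (g := fun n => 8 * h * |t₀ - t n| + 4 * δ n + 2 * δ n) (fun n => ?_) ?_
    · have h1 := hflip n t₀ ht₀ (t n) (ht n)
      have h2 := htx n
      have h3 := dist_triangle (f n t₀) (f n (t n)) x
      linarith
    · have h1 : Filter.Tendsto (fun n => |t₀ - t n|) U (nhds 0) := by
        simpa using (htlim'.const_sub t₀).abs
      simpa using ((h1.const_mul (8 * h)).add (hδU.const_mul 4)).add (hδU.const_mul 2)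
  · intro s hs t ht
    have h1 := (hF s hs).dist (hF t ht)
    have h2 : Filter.Tendsto (fun n => 8 * h * |s - t| + 4 * δ n) U
        (nhds (8 * h * |s - t|)) := by
      simpa using (hδU.const_mul 4).const_add (8 * h * |s - t|)
    exact le_of_tendsto_of_tendsto' h1 h2 fun n => hflip n s hs t ht

end Parametrization

section Contents

variable {M : Type*} [MetricSpace M]

/-- `𝒰` is a finite cover of `Γ` by bounded sets of diameter at most `δ`. -/
structure IsFineCover (Γ : Set M) (δ : ℝ) (𝒰 : Finset (Set M)) : Prop where
  cover : Γ ⊆ ⋃ U ∈ 𝒰, U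
  bounded : ∀ U ∈ 𝒰, IsBounded U
  diam_le : ∀ U ∈ 𝒰, diam U ≤ δ

/-- The total diameter of the most economical finite cover at scale `δ`. -/
def setContent (Γ : Set M) (δ : ℝ) : ℝ :=
  sInf ((fun 𝒰 : Finset (Set M) => ∑ U ∈ 𝒰, diam U) '' {𝒰 | IsFineCover Γ δ 𝒰})

/-- The set `P` of parameters in `[0,1]` cuts the path `F` into pieces of oscillation at
most `δ`. -/
structure IsFinePartition (F : ℝ → M) (δ : ℝ) (P : Set ℝ) : Prop where
  subset : P ⊆ Icc 0 1
  fine : ∀ τ ∈ Icc (0 : ℝ) 1, ∃ p ∈ P, ∃ q ∈ P, p ≤ τ ∧ τ ≤ q ∧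
    ∀ a ∈ Icc p q, ∀ b ∈ Icc p q, dist (F a) (F b) ≤ δ

/-- The least variation of the path `F` along partitions at scale `δ`. -/
def pathContent (F : ℝ → M) (δ : ℝ) : ℝ :=
  sInf ((fun P : Set ℝ => (eVariationOn F P).toReal) '' {P | IsFinePartition F δ P})

lemma setContent_le {Γ : Set M} {δ : ℝ} {𝒰 : Finset (Set M)} (h : IsFineCover Γ δ 𝒰) :
    setContent Γ δ ≤ ∑ U ∈ 𝒰, diam U :=
  csInf_le ⟨0, by rintro _ ⟨𝒱, _, rfl⟩; exact Finset.sum_nonneg fun U _ => diam_nonneg⟩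
    ⟨𝒰, h, rfl⟩

lemma setContent_nonneg (Γ : Set M) (δ : ℝ) : 0 ≤ setContent Γ δ :=
  Real.sInf_nonneg (by rintro _ ⟨𝒱, _, rfl⟩; exact Finset.sum_nonneg fun U _ => diam_nonneg)

lemma pathContent_le {F : ℝ → M} {δ : ℝ} {P : Set ℝ} (h : IsFinePartition F δ P) :
    pathContent F δ ≤ (eVariationOn F P).toReal :=
  csInf_le ⟨0, by rintro _ ⟨Q, _, rfl⟩; exact ENNReal.toReal_nonneg⟩ ⟨P, h, rfl⟩

lemma pathContent_nonneg (F : ℝ → M) (δ : ℝ) : 0 ≤ pathContent F δ :=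
  Real.sInf_nonneg (by rintro _ ⟨Q, _, rfl⟩; exact ENNReal.toReal_nonneg)

lemma exists_isFineCover {F : ℝ → M} {K : ℝ≥0} (hF : LipschitzWith K F) {δ : ℝ} (hδ : 0 < δ) :
    ∃ 𝒰, IsFineCover (F '' Icc 0 1) δ 𝒰 ∧ ∑ U ∈ 𝒰, diam U ≤ K := by
  obtain ⟨n, hn⟩ := exists_nat_gt (K / δ)
  have hn0 : (0 : ℝ) < n := lt_of_le_of_lt (by positivity) hn
  have hnK : (K : ℝ) / n ≤ δ := by
    rw [div_lt_iff₀ hδ] at hn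
    rw [div_le_iff₀ hn0]
    linarith
  let I : ℕ → Set M := fun i => F '' Icc ((i : ℝ) / n) (((i : ℝ) + 1) / n)
  have hI : ∀ i, diam (I i) ≤ K / n := by
    intro i
    refine diam_le_of_forall_dist_le (by positivity) ?_
    rintro _ ⟨s, hs, rfl⟩ _ ⟨t, ht, rfl⟩
    refine (hF.dist_le_mul s t).trans ?_
    rw [div_eq_mul_inv]
    refine mul_le_mul_of_nonneg_left ?_ K.2
    refine (Real.dist_le_of_mem_Icc hs ht).trans ?_
    rw [add_div, add_sub_cancel_left, one_div]
  have hIb : ∀ i, IsBounded (I i) := fun i =>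
    (isCompact_Icc.image hF.continuous).isBounded
  refine ⟨(Finset.range n).image I, ⟨?_, ?_, ?_⟩, ?_⟩
  · rintro _ ⟨t, ht, rfl⟩
    rcases eq_or_lt_of_le ht.2 with rfl | h1
    · refine mem_iUnion₂.2 ⟨I (n - 1), Finset.mem_image_of_mem _ (Finset.mem_range.2 ?_), 1,
        ⟨?_, ?_⟩, rfl⟩
      · have : 0 < n := by exact_mod_cast hn0
        omega
      · rw [div_le_one hn0]
        exact_mod_cast Nat.sub_le n 1
      · rw [one_le_div hn0]
        exact_mod_cast (by omega : n ≤ n - 1 + 1)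
    · have h0 : 0 ≤ t * n := mul_nonneg ht.1 hn0.le
      refine mem_iUnion₂.2 ⟨I ⌊t * n⌋₊, Finset.mem_image_of_mem _ (Finset.mem_range.2 ?_), t,
        ⟨?_, ?_⟩, rfl⟩
      · rw [Nat.floor_lt h0]
        nlinarith
      · rw [div_le_iff₀ hn0]
        exact Nat.floor_le h0
      · rw [le_div_iff₀ hn0]
        exact (Nat.lt_floor_add_one _).le
  · intro U hU
    obtain ⟨i, _, rfl⟩ := Finset.mem_image.1 hU
    exact hIb i
  · intro U hU
    obtain ⟨i, _, rfl⟩ := Finset.mem_image.1 hU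
    exact (hI i).trans hnK
  · calc ∑ U ∈ (Finset.range n).image I, diam U
        ≤ ∑ U ∈ (Finset.range n).image I, (K : ℝ) / n := by
          refine Finset.sum_le_sum fun U hU => ?_
          obtain ⟨i, _, rfl⟩ := Finset.mem_image.1 hU
          exact hI i
      _ = ((Finset.range n).image I).card * ((K : ℝ) / n) := by
          rw [Finset.sum_const, nsmul_eq_mul]
      _ ≤ n * ((K : ℝ) / n) := by
          refine mul_le_mul_of_nonneg_right ?_ (by positivity)
          exact_mod_cast Finset.card_image_le.trans (Finset.card_range n).le
      _ = K := mul_div_cancel₀ _ hn0.ne'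

lemma setContent_le_of_lipschitzWith {F : ℝ → M} {K : ℝ≥0} (hF : LipschitzWith K F) {δ : ℝ}
    (hδ : 0 < δ) : setContent (F '' Icc 0 1) δ ≤ K := by
  obtain ⟨𝒰, h𝒰, hK⟩ := exists_isFineCover hF hδ
  exact (setContent_le h𝒰).trans hK

lemma eVariationOn_le_of_lipschitzWith {F : ℝ → M} {K : ℝ≥0} (hF : LipschitzWith K F)
    {P : Set ℝ} (hP : P ⊆ Icc 0 1) : eVariationOn F P ≤ K := by
  have h := (hF.lipschitzOnWith (s := univ)).comp_eVariationOn_le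
    (g := fun t : ℝ => t) (s := Icc 0 1) (mapsTo_univ _ _)
  have hid : eVariationOn (fun t : ℝ => t) (Icc 0 1) ≤ 1 := by
    have := (monotone_id.monotoneOn (Icc (0 : ℝ) 1)).eVariationOn_eq (a := 0) (b := 1)
      (by simp) (by simp)
    rw [inter_self] at this
    exact this.le.trans (by simp)
  calc eVariationOn F P ≤ eVariationOn F (Icc 0 1) := eVariationOn.mono F hP
    _ ≤ K * eVariationOn (fun t : ℝ => t) (Icc 0 1) := h
    _ ≤ K * 1 := by gcongr
    _ = K := mul_one _

lemma isFinePartition_Icc (F : ℝ → M) {δ : ℝ} (hδ : 0 ≤ δ) : IsFinePartition F δ (Icc 0 1) :=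
  ⟨Subset.rfl, fun τ hτ => ⟨τ, hτ, τ, hτ, le_rfl, le_rfl, fun a ha b hb => by
    rw [le_antisymm ha.2 ha.1, le_antisymm hb.2 hb.1, dist_self]
    exact hδ⟩⟩

lemma pathContent_le_of_lipschitzWith {F : ℝ → M} {K : ℝ≥0} (hF : LipschitzWith K F) {δ : ℝ}
    (hδ : 0 < δ) : pathContent F δ ≤ K := by
  refine (pathContent_le (isFinePartition_Icc F hδ.le)).trans ?_
  have := ENNReal.toReal_mono ENNReal.coe_ne_top (eVariationOn_le_of_lipschitzWith hF Subset.rfl)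
  simpa using this

/-- Replacing disjoint subfamilies of a cover by their unions. -/
lemma setContent_add_sum_le {ι : Type*} {Γ : Set M} {δ δ' : ℝ} (hδ : δ' ≤ δ)
    {𝒰 : Finset (Set M)} (h𝒰 : IsFineCover Γ δ' 𝒰) (Y : Finset ι) (𝒱 : ι → Finset (Set M))
    (hsub : ∀ y ∈ Y, 𝒱 y ⊆ 𝒰)
    (hdisj : ∀ y ∈ Y, ∀ y' ∈ Y, y ≠ y' → Disjoint (𝒱 y) (𝒱 y'))
    (hdiam : ∀ y ∈ Y, diam (⋃ U ∈ 𝒱 y, U) ≤ δ) :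
    setContent Γ δ + ∑ y ∈ Y, (∑ U ∈ 𝒱 y, diam U - diam (⋃ U ∈ 𝒱 y, U)) ≤
      ∑ U ∈ 𝒰, diam U := by
  have hB : Y.biUnion 𝒱 ⊆ 𝒰 := Finset.biUnion_subset.2 hsub
  have hcover : IsFineCover Γ δ (𝒰 \ Y.biUnion 𝒱 ∪ Y.image fun y => ⋃ U ∈ 𝒱 y, U) := by
    refine ⟨fun x hx => ?_, fun U hU => ?_, fun U hU => ?_⟩
    · obtain ⟨U, hU, hxU⟩ := mem_iUnion₂.1 (h𝒰.cover hx)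
      by_cases hUB : U ∈ Y.biUnion 𝒱
      · obtain ⟨y, hy, hUy⟩ := Finset.mem_biUnion.1 hUB
        exact mem_iUnion₂.2 ⟨⋃ U ∈ 𝒱 y, U, Finset.mem_union_right _ (Finset.mem_image_of_mem _ hy),
          mem_iUnion₂.2 ⟨U, hUy, hxU⟩⟩
      · exact mem_iUnion₂.2 ⟨U, Finset.mem_union_left _ (Finset.mem_sdiff.2 ⟨hU, hUB⟩), hxU⟩
    · rcases Finset.mem_union.1 hU with hU | hU
      · exact h𝒰.bounded U (Finset.mem_sdiff.1 hU).1
      · obtain ⟨y, hy, rfl⟩ := Finset.mem_image.1 hU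
        exact (isBounded_biUnion_finset _).2 fun U hU => h𝒰.bounded U (hsub y hy hU)
    · rcases Finset.mem_union.1 hU with hU | hU
      · exact (h𝒰.diam_le U (Finset.mem_sdiff.1 hU).1).trans hδ
      · obtain ⟨y, hy, rfl⟩ := Finset.mem_image.1 hU
        exact hdiam y hy
  have h1 := setContent_le hcover
  have h2 : ∑ U ∈ 𝒰 \ Y.biUnion 𝒱 ∪ Y.image fun y => ⋃ U ∈ 𝒱 y, U, diam U ≤
      ∑ U ∈ 𝒰 \ Y.biUnion 𝒱, diam U + ∑ U ∈ Y.image fun y => ⋃ U ∈ 𝒱 y, U, diam U := by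
    rw [← Finset.sum_union_inter]
    exact le_add_of_nonneg_right (Finset.sum_nonneg fun _ _ => diam_nonneg)
  have h3 : ∑ U ∈ Y.image fun y => ⋃ U ∈ 𝒱 y, U, diam U ≤ ∑ y ∈ Y, diam (⋃ U ∈ 𝒱 y, U) := by
    rw [← Finset.sum_fiberwise_of_maps_to (g := fun y => ⋃ U ∈ 𝒱 y, U)
      (t := Y.image fun y => ⋃ U ∈ 𝒱 y, U) (fun y hy => Finset.mem_image_of_mem _ hy)]
    refine Finset.sum_le_sum fun W hW => ?_
    obtain ⟨y, hy, rfl⟩ := Finset.mem_image.1 hW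
    exact Finset.single_le_sum (f := fun y => diam (⋃ U ∈ 𝒱 y, U)) (fun _ _ => diam_nonneg)
      (Finset.mem_filter.2 ⟨hy, rfl⟩)
  have h4 : ∑ U ∈ Y.biUnion 𝒱, diam U = ∑ y ∈ Y, ∑ U ∈ 𝒱 y, diam U :=
    Finset.sum_biUnion fun y hy y' hy' hyy' => hdisj y hy y' hy' hyy'
  have h5 := Finset.sum_sdiff (f := fun U : Set M => diam U) hB
  rw [Finset.sum_sub_distrib]
  linarith

lemma eVariationOn_diff_Ioo_add_le (F : ℝ → M) {Q : Set ℝ} {a t b : ℝ} (ha : a ∈ Q)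
    (ht : t ∈ Q) (hb : b ∈ Q) (hat : a ≤ t) (htb : t ≤ b) :
    eVariationOn F (Q \ Ioo a b) + (edist (F a) (F t) + edist (F t) (F b)) ≤
      eVariationOn F Q + edist (F a) (F b) := by
  have hab := hat.trans htb
  have hl : IsGreatest (Q ∩ Iic a) a := ⟨⟨ha, mem_Iic.2 le_rfl⟩, fun x hx => hx.2⟩
  have hr : IsLeast (Q ∩ Ici b) b := ⟨⟨hb, mem_Ici.2 le_rfl⟩, fun x hx => hx.2⟩
  have hpair : ∀ {x y : ℝ}, x ≤ y → IsLeast {x, y} x ∧ IsGreatest {x, y} y := fun {x y} h =>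
    ⟨⟨by simp, by simp [h]⟩, ⟨by simp, by simp [h]⟩⟩
  have hcons : ∀ {x y : ℝ} {R : Set ℝ}, x ≤ y → IsLeast R y →
      IsLeast ({x, y} ∪ R) x := fun {x y R} h hR =>
    ⟨by simp, by
      rintro z ((rfl | rfl) | hz)
      · exact le_rfl
      · exact h
      · exact h.trans (hR.2 hz)⟩
  have e1 : eVariationOn F (Q ∩ Iic a ∪ ({a, b} ∪ Q ∩ Ici b)) =
      eVariationOn F (Q ∩ Iic a) + (edist (F a) (F b) + eVariationOn F (Q ∩ Ici b)) := by
    rw [eVariationOn.union F hl (hcons hab hr), eVariationOn.union F (hpair hab).2 hr,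
      eVariationOn.pair]
  have e2 : eVariationOn F (Q ∩ Iic a ∪ ({a, t} ∪ ({t, b} ∪ Q ∩ Ici b))) =
      eVariationOn F (Q ∩ Iic a) + (edist (F a) (F t) + (edist (F t) (F b) +
        eVariationOn F (Q ∩ Ici b))) := by
    rw [eVariationOn.union F hl (hcons hat (hcons htb hr)),
      eVariationOn.union F (hpair hat).2 (hcons htb hr), eVariationOn.union F (hpair htb).2 hr,
      eVariationOn.pair, eVariationOn.pair]
  have s1 : Q \ Ioo a b ⊆ Q ∩ Iic a ∪ ({a, b} ∪ Q ∩ Ici b) := by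
    rintro x ⟨hx, hx'⟩
    by_cases hxa : x ≤ a
    · exact Or.inl ⟨hx, hxa⟩
    · exact Or.inr (Or.inr ⟨hx, by
        by_contra h
        exact hx' ⟨not_le.1 hxa, not_le.1 h⟩⟩)
  have s2 : Q ∩ Iic a ∪ ({a, t} ∪ ({t, b} ∪ Q ∩ Ici b)) ⊆ Q := by
    rintro x (hx | (rfl | rfl) | (rfl | rfl) | hx)
    exacts [hx.1, ha, ht, ht, hb, hx.1]
  calc eVariationOn F (Q \ Ioo a b) + (edist (F a) (F t) + edist (F t) (F b))
      ≤ eVariationOn F (Q ∩ Iic a) + (edist (F a) (F b) + eVariationOn F (Q ∩ Ici b)) +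
          (edist (F a) (F t) + edist (F t) (F b)) := by
        gcongr
        exact (eVariationOn.mono F s1).trans e1.le
    _ = eVariationOn F (Q ∩ Iic a) + (edist (F a) (F t) + (edist (F t) (F b) +
        eVariationOn F (Q ∩ Ici b))) + edist (F a) (F b) := by ring
    _ ≤ eVariationOn F Q + edist (F a) (F b) := by
        gcongr
        exact e2.symm.le.trans (eVariationOn.mono F s2)

/-- Removing from a partition the interior of disjoint blocks with small oscillation. -/
lemma pathContent_add_sum_le {ι : Type*} {F : ℝ → M} {K : ℝ≥0} (hF : LipschitzWith K F)
    {δ δ' : ℝ} (hδ : δ' ≤ δ) {P : Set ℝ} (hP : IsFinePartition F δ' P)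
    (Y : Finset ι) (a t b : ι → ℝ)
    (haP : ∀ y ∈ Y, a y ∈ P) (htP : ∀ y ∈ Y, t y ∈ P) (hbP : ∀ y ∈ Y, b y ∈ P)
    (hat : ∀ y ∈ Y, a y ≤ t y) (htb : ∀ y ∈ Y, t y ≤ b y)
    (hdisj : ∀ y ∈ Y, ∀ y' ∈ Y, y ≠ y' → Disjoint (Icc (a y) (b y)) (Icc (a y') (b y')))
    (hosc : ∀ y ∈ Y, ∀ x ∈ Icc (a y) (b y), ∀ x' ∈ Icc (a y) (b y), dist (F x) (F x') ≤ δ) :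
    pathContent F δ + ∑ y ∈ Y, (dist (F (a y)) (F (t y)) + dist (F (t y)) (F (b y)) -
      dist (F (a y)) (F (b y))) ≤ (eVariationOn F P).toReal := by
  have hnot : ∀ y ∈ Y, ∀ Y' ⊆ Y, y ∉ Y' → ∀ x ∈ Icc (a y) (b y), x ∈ P →
      x ∈ P \ ⋃ y' ∈ Y', Ioo (a y') (b y') := by
    intro y hy Y' hY' hyY' x hx hxP
    refine ⟨hxP, fun hx' => ?_⟩
    obtain ⟨y', hy', hxy'⟩ := mem_iUnion₂.1 hx'
    exact Set.disjoint_left.1 (hdisj y hy y' (hY' hy') fun h => hyY' (h ▸ hy')) hx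
      (Ioo_subset_Icc_self hxy')
  have hsum : ∀ Y' ⊆ Y, eVariationOn F (P \ ⋃ y ∈ Y', Ioo (a y) (b y)) +
      ∑ y ∈ Y', (edist (F (a y)) (F (t y)) + edist (F (t y)) (F (b y))) ≤
      eVariationOn F P + ∑ y ∈ Y', edist (F (a y)) (F (b y)) := by
    intro Y'
    induction Y' using Finset.induction_on with
    | empty => simp
    | insert y Y' hy ih =>
      intro hY'
      have hyY : y ∈ Y := hY' (Finset.mem_insert_self _ _)
      have hY'Y : Y' ⊆ Y := (Finset.subset_insert _ _).trans hY'
      have hins : P \ ⋃ z ∈ insert y Y', Ioo (a z) (b z) =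
          (P \ ⋃ z ∈ Y', Ioo (a z) (b z)) \ Ioo (a y) (b y) := by
        rw [Finset.set_biUnion_insert, sdiff_sdiff, union_comm]
      have h1 := hat y hyY
      have h2 := htb y hyY
      have hstep := eVariationOn_diff_Ioo_add_le F
        (hnot y hyY Y' hY'Y hy (a y) ⟨le_rfl, h1.trans h2⟩ (haP y hyY))
        (hnot y hyY Y' hY'Y hy (t y) ⟨h1, h2⟩ (htP y hyY))
        (hnot y hyY Y' hY'Y hy (b y) ⟨h1.trans h2, le_rfl⟩ (hbP y hyY)) h1 h2
      rw [Finset.sum_insert hy, Finset.sum_insert hy, hins, ← add_assoc]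
      calc _ ≤ eVariationOn F (P \ ⋃ z ∈ Y', Ioo (a z) (b z)) + edist (F (a y)) (F (b y)) +
            ∑ z ∈ Y', (edist (F (a z)) (F (t z)) + edist (F (t z)) (F (b z))) := by gcongr
        _ = eVariationOn F (P \ ⋃ z ∈ Y', Ioo (a z) (b z)) +
            ∑ z ∈ Y', (edist (F (a z)) (F (t z)) + edist (F (t z)) (F (b z))) +
            edist (F (a y)) (F (b y)) := by ring
        _ ≤ eVariationOn F P + ∑ z ∈ Y', edist (F (a z)) (F (b z)) +
            edist (F (a y)) (F (b y)) := by
          exact add_le_add_left (ih hY'Y) _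
        _ = _ := by ring
  set P' := P \ ⋃ y ∈ Y, Ioo (a y) (b y) with hP'
  have hend : ∀ y ∈ Y, a y ∈ P' ∧ b y ∈ P' := by
    intro y hy
    have h12 := (hat y hy).trans (htb y hy)
    constructor
    · refine ⟨haP y hy, fun hx => ?_⟩
      obtain ⟨y', hy', hxy'⟩ := mem_iUnion₂.1 hx
      by_cases h : y = y'
      · subst h
        exact lt_irrefl _ hxy'.1
      · exact Set.disjoint_left.1 (hdisj y hy y' hy' h) ⟨le_rfl, h12⟩
          (Ioo_subset_Icc_self hxy')
    · refine ⟨hbP y hy, fun hx => ?_⟩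
      obtain ⟨y', hy', hxy'⟩ := mem_iUnion₂.1 hx
      by_cases h : y = y'
      · subst h
        exact lt_irrefl _ hxy'.2
      · exact Set.disjoint_left.1 (hdisj y hy y' hy' h) ⟨h12, le_rfl⟩
          (Ioo_subset_Icc_self hxy')
  have hfine : IsFinePartition F δ P' := by
    refine ⟨sdiff_subset.trans hP.subset, fun τ hτ => ?_⟩
    by_cases hτY : τ ∈ ⋃ y ∈ Y, Ioo (a y) (b y)
    · obtain ⟨y, hy, hτy⟩ := mem_iUnion₂.1 hτY
      exact ⟨a y, (hend y hy).1, b y, (hend y hy).2, hτy.1.le, hτy.2.le, hosc y hy⟩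
    · obtain ⟨p, hp, q, hq, hpτ, hτq, hpq⟩ := hP.fine τ hτ
      have hτn : ∀ y ∈ Y, τ ∉ Ioo (a y) (b y) := fun y hy h => hτY (mem_iUnion₂.2 ⟨y, hy, h⟩)
      obtain ⟨p', hp', hpp', hp'τ⟩ : ∃ p' ∈ P', p ≤ p' ∧ p' ≤ τ := by
        by_cases hpY : p ∈ ⋃ y ∈ Y, Ioo (a y) (b y)
        · obtain ⟨y, hy, hpy⟩ := mem_iUnion₂.1 hpY
          refine ⟨b y, (hend y hy).2, hpy.2.le, ?_⟩
          by_contra h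
          exact hτn y hy ⟨hpy.1.trans_le hpτ, not_le.1 h⟩
        · exact ⟨p, ⟨hp, hpY⟩, le_rfl, hpτ⟩
      obtain ⟨q', hq', hqq', hq'τ⟩ : ∃ q' ∈ P', q' ≤ q ∧ τ ≤ q' := by
        by_cases hqY : q ∈ ⋃ y ∈ Y, Ioo (a y) (b y)
        · obtain ⟨y, hy, hqy⟩ := mem_iUnion₂.1 hqY
          refine ⟨a y, (hend y hy).1, hqy.1.le, ?_⟩
          by_contra h
          exact hτn y hy ⟨not_le.1 h, hτq.trans_lt hqy.2⟩
        · exact ⟨q, ⟨hq, hqY⟩, le_rfl, hτq⟩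
      have hsub : Icc p' q' ⊆ Icc p q := Icc_subset_Icc hpp' hqq'
      exact ⟨p', hp', q', hq', hp'τ, hq'τ, fun x hx x' hx' =>
        (hpq x (hsub hx) x' (hsub hx')).trans hδ⟩
  have h1 := pathContent_le hfine
  have hfinP : eVariationOn F P ≠ ⊤ :=
    ((eVariationOn_le_of_lipschitzWith hF hP.subset).trans_lt ENNReal.coe_lt_top).ne
  have hfinP' : eVariationOn F P' ≠ ⊤ :=
    ((eVariationOn_le_of_lipschitzWith hF hfine.subset).trans_lt ENNReal.coe_lt_top).ne
  have h2 := hsum Y Subset.rfl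
  have hf1 : ∑ y ∈ Y, (edist (F (a y)) (F (t y)) + edist (F (t y)) (F (b y))) ≠ ⊤ :=
    ENNReal.sum_ne_top.2 fun y _ => ENNReal.add_ne_top.2 ⟨edist_ne_top _ _, edist_ne_top _ _⟩
  have hf2 : ∑ y ∈ Y, edist (F (a y)) (F (b y)) ≠ ⊤ :=
    ENNReal.sum_ne_top.2 fun y _ => edist_ne_top _ _
  have h3 := ENNReal.toReal_mono (ENNReal.add_ne_top.2 ⟨hfinP, hf2⟩) h2
  rw [ENNReal.toReal_add hfinP' hf1, ENNReal.toReal_add hfinP hf2,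
    ENNReal.toReal_sum (fun y _ => ENNReal.add_ne_top.2 ⟨edist_ne_top _ _, edist_ne_top _ _⟩),
    ENNReal.toReal_sum (fun y _ => edist_ne_top _ _)] at h3
  simp only [ENNReal.toReal_add (edist_ne_top _ _) (edist_ne_top _ _), ← dist_edist] at h3
  rw [Finset.sum_sub_distrib]
  linarith

end Contents

section LineDeviation

variable {X : Type u} [NormedAddCommGroup X] [NormedSpace ℝ X]

/-- Quantitative strict triangle inequality in a uniformly convex space of power type: a point
with small triangle excess is close to the line through the end points. -/
lemma exists_dist_line_rpow_le {p cv : ℝ} (hp : 2 ≤ p) (hcv : 0 < cv)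
    (huc : ∀ x y : X, ‖x‖ ≤ 1 → ‖y‖ ≤ 1 →
      ‖(2⁻¹ : ℝ) • (x + y)‖ ≤ 1 - cv * ‖x - y‖ ^ p)
    {u w v : X} {R : ℝ} (hu : ‖w - u‖ ≤ R) (hv : ‖v - w‖ ≤ R) :
    ∃ θ : ℝ, 2 * cv * ‖w - (u + θ • (v - u))‖ ^ p ≤
      R ^ (p - 1) * (‖w - u‖ + ‖v - w‖ - ‖v - u‖) := by
  rcases eq_or_ne (w - u) 0 with hx | hx
  · obtain rfl : w = u := sub_eq_zero.1 hx
    refine ⟨0, ?_⟩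
    simp [Real.zero_rpow (by linarith : p ≠ 0)]
  rcases eq_or_ne (v - w) 0 with hy | hy
  · obtain rfl : v = w := sub_eq_zero.1 hy
    refine ⟨1, ?_⟩
    simp [Real.zero_rpow (by linarith : p ≠ 0)]
  set x := w - u with hxdef
  set y := v - w with hydef
  have hα : 0 < ‖x‖ := norm_pos_iff.2 hx
  have hβ : 0 < ‖y‖ := norm_pos_iff.2 hy
  set α := ‖x‖ with hαdef
  set β := ‖y‖ with hβdef
  set x' : X := α⁻¹ • x with hx'
  set y' : X := β⁻¹ • y with hy'
  have ex : x = α • x' := by rw [hx', smul_inv_smul₀ hα.ne']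
  have ey : y = β • y' := by rw [hy', smul_inv_smul₀ hβ.ne']
  have nx : ‖x'‖ = 1 := by rw [hx', norm_smul, norm_inv, Real.norm_of_nonneg hα.le,
    inv_mul_cancel₀ hα.ne']
  have ny : ‖y'‖ = 1 := by rw [hy', norm_smul, norm_inv, Real.norm_of_nonneg hβ.le,
    inv_mul_cancel₀ hβ.ne']
  have hmid := huc x' y' nx.le ny.le
  set n := ‖x' - y'‖ with hn
  have hn0 : 0 ≤ n := norm_nonneg _
  set m := min α β with hm
  have hm0 : 0 < m := lt_min hα hβ
  have hgap : 2 * m * (cv * n ^ p) ≤ α + β - ‖v - u‖ := by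
    have e : v - u = (2 * m) • ((2⁻¹ : ℝ) • (x' + y')) + (α - m) • x' + (β - m) • y' := by
      have : v - u = x + y := by rw [hxdef, hydef]; abel
      rw [this, ex, ey]
      module
    have h1 : ‖v - u‖ ≤ 2 * m * ‖(2⁻¹ : ℝ) • (x' + y')‖ + (α - m) + (β - m) := by
      rw [e]
      refine (norm_add₃_le).trans ?_
      rw [norm_smul (2 * m), norm_smul (α - m), norm_smul (β - m), nx, ny,
        Real.norm_of_nonneg (by positivity : 0 ≤ 2 * m),
        Real.norm_of_nonneg (sub_nonneg.2 (min_le_left α β)),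
        Real.norm_of_nonneg (sub_nonneg.2 (min_le_right α β)), mul_one, mul_one]
    nlinarith
  set k := α * β / (α + β) with hk
  have hk0 : 0 < k := by positivity
  have hkm : k ≤ m := by
    rw [hk, div_le_iff₀ (by positivity)]
    rcases min_choice α β with h | h <;> rw [hm, h] <;> nlinarith
  have hkR : k ≤ R := hkm.trans ((min_le_left _ _).trans hu)
  refine ⟨α / (α + β), ?_⟩
  have hdist : ‖w - (u + (α / (α + β)) • (v - u))‖ = k * n := by
    have e : w - (u + (α / (α + β)) • (v - u)) = k • (x' - y') := by
      have h1 : w - (u + (α / (α + β)) • (v - u)) = x - (α / (α + β)) • (x + y) := by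
        rw [hxdef, hydef, sub_add_sub_cancel', sub_add_eq_sub_sub]
      have hk1 : k = α - α / (α + β) * α := by rw [hk]; field_simp; ring
      have hk2 : k = α / (α + β) * β := by rw [hk]; ring
      rw [h1, smul_sub, ex, ey]
      nth_rewrite 1 [hk1]
      rw [hk2]
      module
    rw [e, norm_smul, Real.norm_of_nonneg hk0.le]
  have hkp : k ^ p ≤ R ^ (p - 1) * m := by
    have : k ^ p = k ^ (p - 1) * k := by
      rw [← Real.rpow_add_one hk0.ne', sub_add_cancel]
    rw [this]
    exact mul_le_mul (Real.rpow_le_rpow hk0.le hkR (by linarith)) hkm hk0.le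
      (Real.rpow_nonneg (hk0.le.trans hkR) _)
  rw [hdist, Real.mul_rpow hk0.le hn0]
  have hnp : 0 ≤ cv * n ^ p := by positivity
  have hR : 0 ≤ R ^ (p - 1) := Real.rpow_nonneg (hk0.le.trans hkR) _
  calc 2 * cv * (k ^ p * n ^ p) = k ^ p * (2 * (cv * n ^ p)) := by ring
    _ ≤ R ^ (p - 1) * m * (2 * (cv * n ^ p)) := by gcongr
    _ = R ^ (p - 1) * (2 * m * (cv * n ^ p)) := by ring
    _ ≤ R ^ (p - 1) * (α + β - ‖v - u‖) := by gcongr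

/-- A point near the line spanned by two well separated points, which are in turn near another
line, is near the latter line. -/
lemma exists_dist_line_le_of_three {w p₁ p₂ a' v' a v : X} {ε h τ τ₁ τ₂ s₁ s₂ : ℝ}
    (hw : ‖w - (a' + τ • v')‖ ≤ ε) (h₁ : ‖p₁ - (a' + τ₁ • v')‖ ≤ ε)
    (h₂ : ‖p₂ - (a' + τ₂ • v')‖ ≤ ε) (hs₁ : ‖p₁ - (a + s₁ • v)‖ ≤ h)
    (hs₂ : ‖p₂ - (a + s₂ • v)‖ ≤ h) (hsep : ‖w - p₁‖ + 4 * ε ≤ ‖p₂ - p₁‖) (hne : p₁ ≠ p₂) :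
    ∃ s : ℝ, ‖w - (a + s • v)‖ ≤ 4 * ε + 3 * h := by
  have hp : 0 < ‖p₂ - p₁‖ := norm_pos_iff.2 (sub_ne_zero.2 hne.symm)
  have hε : 0 ≤ ε := (norm_nonneg _).trans hw
  have hh : 0 ≤ h := (norm_nonneg _).trans hs₁
  have hlow : ‖p₂ - p₁‖ ≤ |τ₂ - τ₁| * ‖v'‖ + 2 * ε := by
    have e : p₂ - p₁ = (p₂ - (a' + τ₂ • v')) + (τ₂ - τ₁) • v' - (p₁ - (a' + τ₁ • v')) := by
      module
    rw [e]
    refine (norm_sub_le _ _).trans ?_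
    have := norm_add_le (p₂ - (a' + τ₂ • v')) ((τ₂ - τ₁) • v')
    rw [norm_smul, Real.norm_eq_abs] at this
    linarith
  have hup : |τ - τ₁| * ‖v'‖ ≤ ‖w - p₁‖ + 2 * ε := by
    have e : (τ - τ₁) • v' = (w - p₁) - (w - (a' + τ • v')) + (p₁ - (a' + τ₁ • v')) := by
      module
    rw [← Real.norm_eq_abs, ← norm_smul, e]
    have := norm_add_le ((w - p₁) - (w - (a' + τ • v'))) (p₁ - (a' + τ₁ • v'))
    have := norm_sub_le (w - p₁) (w - (a' + τ • v'))
    linarith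
  have hpos : 0 < |τ₂ - τ₁| * ‖v'‖ := by
    by_contra hcon
    have := norm_nonneg (w - p₁)
    linarith
  have hτ : 0 < |τ₂ - τ₁| := by
    rcases (abs_nonneg (τ₂ - τ₁)).eq_or_lt with h0 | h0
    · rw [← h0, zero_mul] at hpos
      exact absurd hpos (lt_irrefl _)
    · exact h0
  have hv' : 0 < ‖v'‖ := (pos_iff_pos_of_mul_pos hpos).1 hτ
  have hτ' : τ₂ - τ₁ ≠ 0 := abs_pos.1 hτ
  set l := (τ - τ₁) / (τ₂ - τ₁) with hl
  have hl1 : |l| ≤ 1 := by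
    rw [hl, abs_div, div_le_one hτ]
    refine le_of_mul_le_mul_right ?_ hv'
    linarith
  have hl2 : |1 - l| ≤ 2 := by
    rw [abs_le] at hl1 ⊢
    constructor <;> linarith
  refine ⟨s₁ + l * (s₂ - s₁), ?_⟩
  have hτl : τ = τ₁ + l * (τ₂ - τ₁) := by
    rw [hl, div_mul_cancel₀ _ hτ']
    ring
  have e : w - (a + (s₁ + l * (s₂ - s₁)) • v) =
      (w - (a' + τ • v')) - ((1 - l) • (p₁ - (a' + τ₁ • v')) + l • (p₂ - (a' + τ₂ • v'))) +
      ((1 - l) • (p₁ - (a + s₁ • v)) + l • (p₂ - (a + s₂ • v))) := by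
    rw [hτl]
    module
  have hcomb : ∀ {z₁ z₂ : X} {c : ℝ}, ‖z₁‖ ≤ c → ‖z₂‖ ≤ c →
      ‖(1 - l) • z₁ + l • z₂‖ ≤ 3 * c := by
    intro z₁ z₂ c hz₁ hz₂
    refine (norm_add_le _ _).trans ?_
    rw [norm_smul, norm_smul, Real.norm_eq_abs, Real.norm_eq_abs]
    have h1 := mul_le_mul hl2 hz₁ (norm_nonneg _) zero_le_two
    have h2 := mul_le_mul hl1 hz₂ (norm_nonneg _) zero_le_one
    linarith
  rw [e]
  refine (norm_add_le _ _).trans ?_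
  have h3 := norm_sub_le (w - (a' + τ • v'))
    ((1 - l) • (p₁ - (a' + τ₁ • v')) + l • (p₂ - (a' + τ₂ • v')))
  have h4 := hcomb h₁ h₂
  have h5 := hcomb hs₁ hs₂
  linarith

/-- All points of `S` are within `h` of a common line. -/
def IsNearLine (S : Set X) (h : ℝ) : Prop :=
  ∃ a v : X, v ≠ 0 ∧ ∀ x ∈ S, ∃ t : ℝ, ‖x - (a + t • v)‖ ≤ h

/-- The width of the thinnest tube around a line containing `S`. -/
def lineDev (S : Set X) : ℝ :=
  sInf {h | 0 ≤ h ∧ IsNearLine S h}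

lemma lineDev_nonneg (S : Set X) : 0 ≤ lineDev S :=
  Real.sInf_nonneg fun _ h => h.1

lemma lineDev_le {S : Set X} {h : ℝ} (h0 : 0 ≤ h) (hS : IsNearLine S h) : lineDev S ≤ h :=
  csInf_le ⟨0, fun _ h => h.1⟩ ⟨h0, hS⟩

lemma isNearLine_of_subset_closedBall [Nontrivial X] {S : Set X} {y : X} {r : ℝ}
    (hS : S ⊆ closedBall y r) : IsNearLine S r := by
  obtain ⟨v, hv⟩ := exists_ne (0 : X)
  exact ⟨y, v, hv, fun x hx => ⟨0, by simpa [dist_eq_norm] using hS hx⟩⟩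

lemma lineDev_le_of_subset_closedBall [Nontrivial X] {S : Set X} {y : X} {r : ℝ} (hr : 0 ≤ r)
    (hS : S ⊆ closedBall y r) : lineDev S ≤ r :=
  lineDev_le hr (isNearLine_of_subset_closedBall hS)

lemma IsNearLine.mono {S T : Set X} {h h' : ℝ} (hT : IsNearLine T h) (hST : S ⊆ T)
    (hh : h ≤ h') : IsNearLine S h' := by
  obtain ⟨a, v, hv, H⟩ := hT
  exact ⟨a, v, hv, fun x hx => (H x (hST hx)).imp fun t ht => ht.trans hh⟩

lemma isNearLine_of_lineDev_lt [Nontrivial X] {S : Set X} (hS : IsBounded S) {h : ℝ}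
    (hh : lineDev S < h) : IsNearLine S h := by
  obtain ⟨r, hr⟩ := hS.subset_closedBall (0 : X)
  have hr' : S ⊆ closedBall 0 (max r 0) := hr.trans (closedBall_subset_closedBall (le_max_left _ _))
  obtain ⟨h', hh', hlt⟩ := exists_lt_of_csInf_lt
    (⟨max r 0, le_max_right _ _, isNearLine_of_subset_closedBall hr'⟩ :
      {h | 0 ≤ h ∧ IsNearLine S h}.Nonempty) hh
  exact hh'.2.mono Subset.rfl hlt.le

end LineDeviation

section Local

lemma exists_first_exit {φ : ℝ → ℝ} (hφ : Continuous φ) {x₀ x₁ c : ℝ} (h01 : x₀ ≤ x₁)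
    (h0 : φ x₀ ≤ c) (h1 : c ≤ φ x₁) :
    ∃ b ∈ Icc x₀ x₁, φ b = c ∧ ∀ t ∈ Icc x₀ b, φ t ≤ c := by
  have hS : IsCompact (Icc x₀ x₁ ∩ {t | c ≤ φ t}) :=
    isCompact_Icc.inter_right (isClosed_le continuous_const hφ)
  obtain ⟨b, ⟨hb, hcb⟩, hleast⟩ := hS.exists_isLeast ⟨x₁, ⟨h01, le_rfl⟩, h1⟩
  have hbc : φ b = c := by
    obtain ⟨t, ht, htc⟩ := intermediate_value_Icc hb.1 hφ.continuousOn ⟨h0, hcb⟩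
    have : b ≤ t := hleast ⟨⟨ht.1, ht.2.trans hb.2⟩, htc.symm.le⟩
    rw [le_antisymm this ht.2, htc]
  refine ⟨b, hb, hbc, fun t ht => ?_⟩
  rcases eq_or_lt_of_le ht.2 with rfl | hlt
  · exact hbc.le
  · by_contra hcon
    exact absurd (hleast ⟨⟨ht.1, ht.2.trans hb.2⟩, (not_le.1 hcon).le⟩) (not_le.2 hlt)

lemma exists_last_entry {φ : ℝ → ℝ} (hφ : Continuous φ) {x₀ x₁ c : ℝ} (h01 : x₀ ≤ x₁)
    (h0 : c ≤ φ x₀) (h1 : φ x₁ ≤ c) :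
    ∃ a ∈ Icc x₀ x₁, φ a = c ∧ ∀ t ∈ Icc a x₁, φ t ≤ c := by
  obtain ⟨b, hb, hbc, H⟩ := exists_first_exit (φ := fun t => φ (-t)) (by fun_prop)
    (neg_le_neg h01) (by simpa using h1) (by simpa using h0)
  exact ⟨-b, ⟨by linarith [hb.2], by linarith [hb.1]⟩, hbc, fun t ht => by
    simpa using H (-t) ⟨by linarith [ht.2], by linarith [ht.1]⟩⟩

lemma rpow_mul_rpow_one_sub_le {p d r : ℝ} (hp : 0 ≤ p) (hd : 0 ≤ d) (hr : 0 < r) (hdr : d ≤ r) :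
    d ^ p * r ^ (1 - p) ≤ r := by
  calc d ^ p * r ^ (1 - p) ≤ r ^ p * r ^ (1 - p) := by gcongr
    _ = r := by rw [← Real.rpow_add hr, add_sub_cancel, Real.rpow_one]

lemma subset_closedBall_of_inter_nonempty {M : Type*} [MetricSpace M] {U : Set M} {z : M}
    {ρ δ : ℝ} (hb : IsBounded U) (hd : diam U ≤ δ) (h : (U ∩ closedBall z ρ).Nonempty) :
    U ⊆ closedBall z (ρ + δ) := by
  obtain ⟨x, hxU, hxz⟩ := h
  intro x' hx'
  have h1 := dist_le_diam_of_mem hb hx' hxU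
  have h2 := dist_triangle x' x z
  rw [mem_closedBall] at hxz ⊢
  linarith

/-- The members of a fine cover that meet a ball centred on a connected set. -/
lemma le_sum_diam_filter {M : Type*} [MetricSpace M] {Γ : Set M} (hΓ : IsPreconnected Γ)
    {x y : M} (hx : x ∈ Γ) (hy : y ∈ Γ) {l δ : ℝ} (hl : l ≤ dist x y) {𝒰 : Finset (Set M)}
    (h𝒰 : IsFineCover Γ δ 𝒰) :
    l ≤ ∑ U ∈ 𝒰 with (U ∩ closedBall x l).Nonempty, diam U := by
  refine le_sum_diam_of_isPreconnected hΓ hx hy hl _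
    (fun U hU => h𝒰.bounded U (Finset.mem_filter.1 hU).1) ?_
  rintro z ⟨hz, hzx⟩
  obtain ⟨U, hU, hzU⟩ := mem_iUnion₂.1 (h𝒰.cover hz)
  exact mem_iUnion₂.2 ⟨U, Finset.mem_filter.2 ⟨hU, z, hzU, hzx⟩, hzU⟩

variable {X : Type u} [NormedAddCommGroup X] [NormedSpace ℝ X]

/-- Either the curve is equally bent at a smaller scale nearby, or a block of the partition has
large triangle excess, or part of the cover is wasteful. -/
lemma local_trichotomy [Nontrivial X] {p cv η : ℝ} (hp : 2 ≤ p) (hcv : 0 < cv)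
    (huc : ∀ x y : X, ‖x‖ ≤ 1 → ‖y‖ ≤ 1 →
      ‖(2⁻¹ : ℝ) • (x + y)‖ ≤ 1 - cv * ‖x - y‖ ^ p)
    (hη0 : 0 < η) (hη1 : η * 6 ^ (p - 1) * 100 ^ p ≤ 2 * cv) (hη2 : η ≤ 1 / (100 * 2 ^ 15))
    {F : ℝ → X} (hF : Continuous F) {y : X} {r δ : ℝ} (hr : 0 < r)
    (hy : y ∈ F '' Icc 0 1) (hy0 : 2 * r ≤ dist y (F 0)) (hy1 : 2 * r ≤ dist y (F 1))
    {P : Set ℝ} {𝒰 : Finset (Set X)} (hδ : δ ≤ r / 2 ^ 15 / 1000)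
    (hP : IsFinePartition F δ P) (h𝒰 : IsFineCover (F '' Icc 0 1) δ 𝒰) {d : ℝ}
    (hd : d = lineDev (F '' Icc 0 1 ∩ closedBall y r)) :
    (∃ z ∈ F '' Icc 0 1, dist z y ≤ r ∧
      d / 100 ≤ lineDev (F '' Icc 0 1 ∩ closedBall z (r / 2 ^ 15))) ∨
    (∃ a ∈ P, ∃ t ∈ P, ∃ b ∈ P, a ≤ t ∧ t ≤ b ∧ F '' Icc a b ⊆ closedBall y (3 * r) ∧
      η * (d ^ p * r ^ (1 - p)) ≤
        dist (F a) (F t) + dist (F t) (F b) - dist (F a) (F b)) ∨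
    (∃ 𝒱 ⊆ 𝒰, (∀ U ∈ 𝒱, U ⊆ closedBall y (3 * r)) ∧ diam (⋃ U ∈ 𝒱, U) ≤ 6 * r ∧
      r / 2 ^ 15 / 32 ≤ ∑ U ∈ 𝒱, diam U - diam (⋃ U ∈ 𝒱, U)) := by
  set Γ := F '' Icc 0 1 with hΓ
  set s := r / 2 ^ 15 with hs
  have hsr : r = 2 ^ 15 * s := by rw [hs]; ring
  have hs0 : 0 < s := by positivity
  by_contra! hcon
  obtain ⟨hA, hB1, hB2⟩ := hcon
  have hd0 : 0 ≤ d := hd ▸ lineDev_nonneg _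
  have hdpos : 0 < d := by
    have h1 := hA y hy (by simpa using hr.le)
    have h2 := lineDev_nonneg (Γ ∩ closedBall y s)
    linarith
  have hdr : d ≤ r := hd ▸ lineDev_le_of_subset_closedBall hr.le inter_subset_right
  have hδ0 : 0 ≤ δ := by
    obtain ⟨q, hq, q', hq', h1, h2, h3⟩ := hP.fine 0 (by simp)
    exact dist_nonneg.trans (h3 0 ⟨h1, h2⟩ 0 ⟨h1, h2⟩)
  obtain ⟨t₀, ht₀, hFt₀⟩ := hy
  have hcont : ∀ x : X, Continuous fun t => dist x (F t) := fun x => continuous_const.dist hF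
  -- the arc through `y`
  obtain ⟨a₀, ha₀, ha₀r, ha₀t⟩ := exists_last_entry (hcont y) ht₀.1 hy0
    (by rw [hFt₀, dist_self]; linarith)
  obtain ⟨b₀, hb₀, hb₀r, hb₀t⟩ := exists_first_exit (hcont y) ht₀.2
    (by rw [hFt₀, dist_self]; linarith) hy1
  have harc : ∀ t ∈ Icc a₀ b₀, dist y (F t) ≤ 2 * r := by
    intro t ht
    rcases le_total t t₀ with h | h
    · exact ha₀t t ⟨ht.1, h⟩
    · exact hb₀t t ⟨h, ht.2⟩
  have ha₀I : a₀ ∈ Icc (0 : ℝ) 1 := ⟨ha₀.1, ha₀.2.trans ht₀.2⟩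
  have hb₀I : b₀ ∈ Icc (0 : ℝ) 1 := ⟨ht₀.1.trans hb₀.1, hb₀.2⟩
  have hab₀ : a₀ ≤ b₀ := ha₀.2.trans hb₀.1
  obtain ⟨a, ha, a', ha', haa₀, haa', haosc⟩ := hP.fine a₀ ha₀I
  obtain ⟨b', hb', b, hb, hbb', hbb₀, hbosc⟩ := hP.fine b₀ hb₀I
  have hab : a ≤ b := haa₀.trans (hab₀.trans hbb₀)
  have hFaa : dist (F a₀) (F a) ≤ δ := haosc _ ⟨haa₀, haa'⟩ _ ⟨le_rfl, haa₀.trans haa'⟩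
  have hFbb : dist (F b₀) (F b) ≤ δ := hbosc _ ⟨hbb', hbb₀⟩ _ ⟨hbb'.trans hbb₀, le_rfl⟩
  have hin : ∀ t ∈ Icc a b, dist y (F t) ≤ 2 * r + δ := by
    intro t ht
    by_cases h1 : t < a₀
    · have := haosc a₀ ⟨haa₀, haa'⟩ t ⟨ht.1, h1.le.trans haa'⟩
      have := dist_triangle y (F a₀) (F t)
      linarith
    by_cases h2 : b₀ < t
    · have := hbosc b₀ ⟨hbb', hbb₀⟩ t ⟨hbb'.trans h2.le, ht.2⟩
      have := dist_triangle y (F b₀) (F t)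
      linarith
    linarith [harc t ⟨not_lt.1 h1, not_lt.1 h2⟩]
  have hball : F '' Icc a b ⊆ closedBall y (3 * r) := by
    rintro _ ⟨t, ht, rfl⟩
    rw [mem_closedBall, dist_comm]
    linarith [hin t ht]
  have hPI : ∀ t ∈ Icc a b, t ∈ Icc (0 : ℝ) 1 := fun t ht =>
    ⟨(hP.subset ha).1.trans ht.1, ht.2.trans (hP.subset hb).2⟩
  have hnear : ∀ τ ∈ Icc a b, ∃ q ∈ P, q ∈ Icc a b ∧ dist (F τ) (F q) ≤ δ := by
    intro τ hτ
    obtain ⟨q, hq, q', hq', hqτ, hτq', hosc⟩ := hP.fine τ (hPI τ hτ)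
    rcases le_total a q with h | h
    · exact ⟨q, hq, ⟨h, hqτ.trans hτ.2⟩, hosc _ ⟨hqτ, hτq'⟩ _ ⟨le_rfl, hqτ.trans hτq'⟩⟩
    · exact ⟨a, ha, ⟨le_rfl, hab⟩, hosc _ ⟨hqτ, hτq'⟩ _ ⟨h, hτ.1.trans hτq'⟩⟩
  -- small excess puts the partition points near the chord
  have hval : d ^ p * r ^ (1 - p) ≤ r := rpow_mul_rpow_one_sub_le (by linarith) hd0 hr hdr
  have hexc : ∀ t ∈ P, t ∈ Icc a b →
      dist (F a) (F t) + dist (F t) (F b) - dist (F a) (F b) < η * (d ^ p * r ^ (1 - p)) :=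
    fun t ht htI => hB1 a ha t ht b hb htI.1 htI.2 hball
  have hchord : ∀ t ∈ P, t ∈ Icc a b →
      ∃ θ : ℝ, ‖F t - (F a + θ • (F b - F a))‖ ≤ d / 100 := by
    intro t ht htI
    have h6 : ∀ t' ∈ Icc a b, ∀ t'' ∈ Icc a b, ‖F t' - F t''‖ ≤ 6 * r := by
      intro t' ht' t'' ht''
      rw [← dist_eq_norm]
      have h1 := mem_closedBall.1 (hball ⟨t', ht', rfl⟩)
      have h2 := mem_closedBall.1 (hball ⟨t'', ht'', rfl⟩)
      have h3 := dist_triangle_right (F t') (F t'') y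
      linarith
    obtain ⟨θ, hθ⟩ := exists_dist_line_rpow_le hp hcv huc
      (h6 t htI a ⟨le_rfl, hab⟩) (h6 b ⟨hab, le_rfl⟩ t htI)
    refine ⟨θ, ?_⟩
    set D := ‖F t - (F a + θ • (F b - F a))‖ with hD
    have hD0 : 0 ≤ D := norm_nonneg _
    have he : ‖F t - F a‖ + ‖F b - F t‖ - ‖F b - F a‖ ≤ η * (d ^ p * r ^ (1 - p)) := by
      have := (hexc t ht htI).le
      rwa [dist_eq_norm', dist_eq_norm', dist_eq_norm'] at this
    have h1 : 2 * cv * D ^ p ≤ η * 6 ^ (p - 1) * d ^ p := by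
      calc 2 * cv * D ^ p ≤ (6 * r) ^ (p - 1) * (η * (d ^ p * r ^ (1 - p))) :=
            hθ.trans (mul_le_mul_of_nonneg_left he (by positivity))
        _ = η * 6 ^ (p - 1) * d ^ p * (r ^ (p - 1) * r ^ (1 - p)) := by
            rw [Real.mul_rpow (by norm_num) hr.le]; ring
        _ = η * 6 ^ (p - 1) * d ^ p := by
            rw [← Real.rpow_add hr, show p - 1 + (1 - p) = 0 by ring, Real.rpow_zero, mul_one]
    have h2 : (100 * D) ^ p ≤ d ^ p := by
      rw [Real.mul_rpow (by norm_num) hD0]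
      refine le_of_mul_le_mul_left ?_ (by positivity : 0 < 2 * cv)
      calc 2 * cv * (100 ^ p * D ^ p) = 100 ^ p * (2 * cv * D ^ p) := by ring
        _ ≤ 100 ^ p * (η * 6 ^ (p - 1) * d ^ p) := by gcongr
        _ = η * 6 ^ (p - 1) * 100 ^ p * d ^ p := by ring
        _ ≤ 2 * cv * d ^ p := by gcongr
    have h3 := (Real.rpow_le_rpow_iff (by positivity) hd0 (by linarith)).1 h2
    linarith
  -- the chord is long
  have hg : η * (d ^ p * r ^ (1 - p)) ≤ s / 100 := by
    calc η * (d ^ p * r ^ (1 - p)) ≤ 1 / (100 * 2 ^ 15) * r := by gcongr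
      _ = s / 100 := by rw [hsr]; ring
  have hlong : 4 * r - 4 * δ - s / 100 ≤ dist (F a) (F b) := by
    obtain ⟨q, hq, hqI, hqδ⟩ := hnear t₀ ⟨haa₀.trans ha₀.2, hb₀.1.trans hbb₀⟩
    rw [hFt₀] at hqδ
    have h1 := hexc q hq hqI
    have h2 := dist_triangle4 y (F q) (F a) (F a₀)
    have h3 := dist_triangle4 y (F q) (F b) (F b₀)
    rw [dist_comm (F q) (F a), dist_comm (F a) (F a₀)] at h2
    rw [dist_comm (F b) (F b₀)] at h3
    linarith
  have hne : F b - F a ≠ 0 := by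
    intro h0
    rw [sub_eq_zero] at h0
    rw [h0, dist_self] at hlong
    linarith
  -- a point of the curve far from the chord
  obtain ⟨z, hzΓ, hzy, hzfar⟩ : ∃ z ∈ Γ, dist z y ≤ r ∧
      ∀ θ : ℝ, d / 2 < ‖z - (F a + θ • (F b - F a))‖ := by
    by_contra! h
    have : lineDev (Γ ∩ closedBall y r) ≤ d / 2 :=
      lineDev_le (by linarith) ⟨F a, F b - F a, hne, fun z hz => h z hz.1 hz.2⟩
    linarith
  have hsep : ∀ τ ∈ Icc a b, s / 8 < dist z (F τ) := by
    intro τ hτ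
    by_contra! hzτ
    obtain ⟨q, hq, hqI, hqδ⟩ := hnear τ hτ
    obtain ⟨θ, hθ⟩ := hchord q hq hqI
    have hzq : dist z (F q) ≤ s / 8 + δ := (dist_triangle _ (F τ) _).trans (by linarith)
    rcases le_total s d with hsd | hds
    · have h1 := hzfar θ
      have h2 := norm_sub_le_norm_sub_add_norm_sub z (F q) (F a + θ • (F b - F a))
      rw [← dist_eq_norm z (F q)] at h2
      linarith
    · obtain ⟨l, v, hv, hlv⟩ := isNearLine_of_lineDev_lt
        (isBounded_closedBall.subset inter_subset_right) (hA z hzΓ hzy)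
      have hzb : s / 2 ≤ dist z (F b) := by
        have h1 := dist_triangle4 y z (F b) (F b₀)
        rw [hb₀r, dist_comm (F b) (F b₀), dist_comm y z] at h1
        linarith
      obtain ⟨τ', hτ', hzτ', -⟩ := exists_first_exit (hcont z) hτ.2 (c := s / 2) (by linarith) hzb
      obtain ⟨q', hq', hq'I, hq'δ⟩ := hnear τ' ⟨hτ.1.trans hτ'.1, hτ'.2⟩
      obtain ⟨θ', hθ'⟩ := hchord q' hq' hq'I
      have h1 := dist_triangle z (F q') (F τ')
      have h2 := dist_triangle z (F τ') (F q')
      have h3 := dist_triangle (F q') (F q) z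
      have h4 := dist_triangle z (F q) (F q')
      rw [dist_comm (F q') (F τ')] at h1
      rw [dist_comm (F q) (F q')] at h4
      obtain ⟨w₀, hw₀⟩ := hlv z ⟨hzΓ, mem_closedBall_self hs0.le⟩
      obtain ⟨w₁, hw₁⟩ := hlv (F q) ⟨⟨q, hPI q hqI, rfl⟩, by
        rw [mem_closedBall, dist_comm]; linarith⟩
      obtain ⟨w₂, hw₂⟩ := hlv (F q') ⟨⟨q', hPI q' hq'I, rfl⟩, by
        rw [mem_closedBall, dist_comm]; linarith⟩
      have hqq : 3 * s / 8 - 2 * δ ≤ dist (F q') (F q) := by linarith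
      obtain ⟨θ₁, hθ₁⟩ := exists_dist_line_le_of_three hw₀ hw₁ hw₂ hθ hθ'
        (by rw [← dist_eq_norm, ← dist_eq_norm]; linarith)
        (fun h => by rw [h, dist_self] at hqq; linarith)
      have := hzfar θ₁
      linarith
  -- the cover is wasteful near `z`
  set 𝒱₁ : Finset (Set X) := {U ∈ 𝒰 | (U ∩ F '' Icc a₀ b₀).Nonempty} with h𝒱₁
  set 𝒱₂ : Finset (Set X) := {U ∈ 𝒰 | (U ∩ closedBall z (s / 16)).Nonempty} with h𝒱₂
  have hsum₁ : dist (F a₀) (F b₀) ≤ ∑ U ∈ 𝒱₁, diam U := by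
    refine le_sum_diam_of_isPreconnected (isPreconnected_Icc.image F hF.continuousOn)
      ⟨a₀, ⟨le_rfl, hab₀⟩, rfl⟩ ⟨b₀, ⟨hab₀, le_rfl⟩, rfl⟩ le_rfl 𝒱₁
      (fun U hU => h𝒰.bounded U (Finset.mem_filter.1 hU).1) ?_
    rintro x ⟨⟨t, ht, rfl⟩, -⟩
    obtain ⟨U, hU, hxU⟩ := mem_iUnion₂.1
      (h𝒰.cover ⟨t, ⟨ha₀I.1.trans ht.1, ht.2.trans hb₀I.2⟩, rfl⟩)
    exact mem_iUnion₂.2 ⟨U, Finset.mem_filter.2 ⟨hU, F t, hxU, t, ht, rfl⟩, hxU⟩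
  have hsum₂ : s / 16 ≤ ∑ U ∈ 𝒱₂, diam U := by
    refine le_sum_diam_filter (isPreconnected_Icc.image F hF.continuousOn) hzΓ
      (y := F 0) ⟨0, by simp, rfl⟩ ?_ h𝒰
    have := dist_triangle_left y (F 0) z
    linarith
  have hdisj : Disjoint 𝒱₁ 𝒱₂ := by
    refine Finset.disjoint_left.2 fun U hU₁ hU₂ => ?_
    obtain ⟨hU, x, hxU, t, ht, rfl⟩ := Finset.mem_filter.1 hU₁
    have h1 := subset_closedBall_of_inter_nonempty (h𝒰.bounded U hU) (h𝒰.diam_le U hU)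
      (Finset.mem_filter.1 hU₂).2 hxU
    rw [mem_closedBall, dist_comm] at h1
    have h2 := hsep t ⟨haa₀.trans ht.1, ht.2.trans hbb₀⟩
    linarith
  have hsub : ∀ U ∈ 𝒱₁ ∪ 𝒱₂, U ⊆ closedBall y (2 * r + δ) := by
    intro U hU
    rcases Finset.mem_union.1 hU with hU | hU
    · obtain ⟨hU, x, hxU, t, ht, rfl⟩ := Finset.mem_filter.1 hU
      refine subset_closedBall_of_inter_nonempty (h𝒰.bounded U hU) (h𝒰.diam_le U hU)
        ⟨F t, hxU, ?_⟩
      rw [mem_closedBall, dist_comm]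
      exact harc t ht
    · obtain ⟨hU, hUz⟩ := Finset.mem_filter.1 hU
      refine (subset_closedBall_of_inter_nonempty (h𝒰.bounded U hU) (h𝒰.diam_le U hU) hUz).trans
        (closedBall_subset_closedBall' ?_)
      linarith
  have hdiam : diam (⋃ U ∈ 𝒱₁ ∪ 𝒱₂, U) ≤ 2 * (2 * r + δ) :=
    (diam_mono (iUnion₂_subset hsub) isBounded_closedBall).trans (diam_closedBall (by linarith))
  have := hB2 (𝒱₁ ∪ 𝒱₂) (Finset.union_subset (Finset.filter_subset _ _) (Finset.filter_subset _ _))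
    (fun U hU => (hsub U hU).trans (closedBall_subset_closedBall (by linarith))) (by linarith)
  rw [Finset.sum_union hdisj] at this
  have h1 := dist_triangle4 (F a) (F a₀) (F b₀) (F b)
  rw [dist_comm (F a) (F a₀)] at h1
  linarith

end Local

section Scales

lemma card_mul_le_sum_diam_filter {M : Type*} [MetricSpace M] {Γ : Set M} (hΓ : IsPreconnected Γ)
    {l δ : ℝ} {𝒰 : Finset (Set M)} (h𝒰 : IsFineCover Γ δ 𝒰) (Y : Finset M)
    (hY : ∀ x ∈ Y, x ∈ Γ ∧ ∃ y ∈ Γ, l ≤ dist x y)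
    (hsep : ∀ x ∈ Y, ∀ x' ∈ Y, x ≠ x' → 2 * l + δ < dist x x') :
    Y.card * l ≤ ∑ U ∈ 𝒰 with ∃ x ∈ Y, (U ∩ closedBall x l).Nonempty, diam U := by
  have e : ({U ∈ 𝒰 | ∃ x ∈ Y, (U ∩ closedBall x l).Nonempty} : Finset (Set M)) =
      Y.biUnion fun x => {U ∈ 𝒰 | (U ∩ closedBall x l).Nonempty} := by
    ext U
    simp only [Finset.mem_filter, Finset.mem_biUnion]
    constructor
    · rintro ⟨hU, x, hx, h⟩
      exact ⟨x, hx, hU, h⟩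
    · rintro ⟨x, hx, hU, h⟩
      exact ⟨hU, x, hx, h⟩
  rw [e, Finset.sum_biUnion, ← nsmul_eq_mul, ← Finset.sum_const]
  · refine Finset.sum_le_sum fun x hx => ?_
    obtain ⟨hxΓ, y, hy, hxy⟩ := hY x hx
    exact le_sum_diam_filter hΓ hxΓ hy hxy h𝒰
  · intro x hx x' hx' hne
    refine Finset.disjoint_left.2 fun U hU hU' => ?_
    obtain ⟨hU, hUx⟩ := Finset.mem_filter.1 hU
    obtain ⟨z, hzU, hzx'⟩ := (Finset.mem_filter.1 hU').2
    have h1 := subset_closedBall_of_inter_nonempty (h𝒰.bounded U hU) (h𝒰.diam_le U hU) hUx hzU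
    rw [mem_closedBall] at h1 hzx'
    have h2 := hsep x hx x' hx' hne
    have h3 := dist_triangle_left x x' z
    linarith

variable {X : Type u} [NormedAddCommGroup X] [NormedSpace ℝ X]

/-- The points of the path `F` at distance at least `2 * r` from its end points. -/
def pathCore (F : ℝ → X) (r : ℝ) : Set X :=
  {y | y ∈ F '' Icc 0 1 ∧ 2 * r ≤ dist y (F 0) ∧ 2 * r ≤ dist y (F 1)}

/-- The scale invariant deviation of the path `F` from a line in the ball `B(y,r)`,
normalised to have the dimension of a length. -/
def bend (F : ℝ → X) (p : ℝ) (y : X) (r : ℝ) : ℝ :=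
  lineDev (F '' Icc 0 1 ∩ closedBall y r) ^ p * r ^ (1 - p)

/-- A family of centres for which the balls of radius `3 * r` are disjoint. -/
def IsSparse (F : ℝ → X) (r : ℝ) (Y : Finset X) : Prop :=
  (∀ y ∈ Y, y ∈ pathCore F r) ∧ ∀ y ∈ Y, ∀ y' ∈ Y, y ≠ y' → 6 * r < dist y y'

/-- The largest total bending over sparse families at scale `r`. -/
def bendSum (F : ℝ → X) (p r : ℝ) : ℝ :=
  sSup ((fun Y : Finset X => ∑ y ∈ Y, bend F p y r) '' {Y | IsSparse F r Y})

lemma bend_nonneg (F : ℝ → X) (p : ℝ) (y : X) {r : ℝ} (hr : 0 < r) : 0 ≤ bend F p y r := by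
  have := lineDev_nonneg (F '' Icc 0 1 ∩ closedBall y r)
  unfold bend
  positivity

lemma bend_le [Nontrivial X] (F : ℝ → X) {p : ℝ} (hp : 0 ≤ p) (y : X) {r : ℝ} (hr : 0 < r) :
    bend F p y r ≤ r :=
  rpow_mul_rpow_one_sub_le hp (lineDev_nonneg _) hr
    (lineDev_le_of_subset_closedBall hr.le inter_subset_right)

lemma sum_bend_le_of_isSparse [Nontrivial X] {F : ℝ → X} {K : ℝ≥0} (hF : LipschitzWith K F)
    {p : ℝ} (hp : 0 ≤ p) {r : ℝ} (hr : 0 < r) {Y : Finset X} (hY : IsSparse F r Y) :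
    ∑ y ∈ Y, bend F p y r ≤ K := by
  obtain ⟨𝒰, h𝒰, hK⟩ := exists_isFineCover hF hr
  calc ∑ y ∈ Y, bend F p y r ≤ ∑ y ∈ Y, r := Finset.sum_le_sum fun y _ => bend_le F hp y hr
    _ = Y.card * r := by rw [Finset.sum_const, nsmul_eq_mul]
    _ ≤ ∑ U ∈ 𝒰 with ∃ x ∈ Y, (U ∩ closedBall x r).Nonempty, diam U := by
      refine card_mul_le_sum_diam_filter (isPreconnected_Icc.image F hF.continuous.continuousOn)
        h𝒰 Y (fun x hx => ⟨(hY.1 x hx).1, F 0, ⟨0, by simp, rfl⟩, ?_⟩) fun x hx x' hx' h => ?_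
      · linarith [(hY.1 x hx).2.1]
      · linarith [hY.2 x hx x' hx' h]
    _ ≤ ∑ U ∈ 𝒰, diam U :=
      Finset.sum_le_sum_of_subset_of_nonneg (Finset.filter_subset _ _) fun _ _ _ => diam_nonneg
    _ ≤ K := hK

lemma sum_bend_le_bendSum [Nontrivial X] {F : ℝ → X} {K : ℝ≥0} (hF : LipschitzWith K F)
    {p : ℝ} (hp : 0 ≤ p) {r : ℝ} (hr : 0 < r) {Y : Finset X} (hY : IsSparse F r Y) :
    ∑ y ∈ Y, bend F p y r ≤ bendSum F p r :=
  le_csSup ⟨K, by rintro _ ⟨Z, hZ, rfl⟩; exact sum_bend_le_of_isSparse hF hp hr hZ⟩ ⟨Y, hY, rfl⟩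

lemma bendSum_le [Nontrivial X] {F : ℝ → X} {p r B : ℝ}
    (h : ∀ Y, IsSparse F r Y → ∑ y ∈ Y, bend F p y r ≤ B) : bendSum F p r ≤ B :=
  csSup_le ⟨0, ∅, by simp [IsSparse], by simp⟩ (by rintro _ ⟨Y, hY, rfl⟩; exact h Y hY)

lemma bendSum_nonneg [Nontrivial X] {F : ℝ → X} {K : ℝ≥0} (hF : LipschitzWith K F)
    {p : ℝ} (hp : 0 ≤ p) {r : ℝ} (hr : 0 < r) : 0 ≤ bendSum F p r := by
  simpa using sum_bend_le_bendSum hF hp hr (Y := ∅) (by simp [IsSparse])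

lemma hundred_rpow_mul_le {p : ℝ} (hp : 2 ≤ p) :
    (100 : ℝ) ^ p * ((2 : ℝ) ^ 15) ^ (1 - p) ≤ 1 / 2 := by
  calc (100 : ℝ) ^ p * ((2 : ℝ) ^ 15) ^ (1 - p)
      ≤ ((2 : ℝ) ^ (7 : ℝ)) ^ p * ((2 : ℝ) ^ (15 : ℝ)) ^ (1 - p) := by
        refine mul_le_mul (Real.rpow_le_rpow (by norm_num) (by norm_num) (by linarith)) ?_
          (by positivity) (by positivity)
        norm_num
    _ = (2 : ℝ) ^ (7 * p + 15 * (1 - p)) := by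
        rw [← Real.rpow_mul zero_le_two, ← Real.rpow_mul zero_le_two, ← Real.rpow_add two_pos]
    _ ≤ (2 : ℝ) ^ (-1 : ℝ) := Real.rpow_le_rpow_of_exponent_le one_le_two (by linarith)
    _ = 1 / 2 := by rw [Real.rpow_neg_one]; norm_num

lemma sum_bend_le_of_isFine [Nontrivial X] {p cv η : ℝ} (hp : 2 ≤ p) (hcv : 0 < cv)
    (huc : ∀ x y : X, ‖x‖ ≤ 1 → ‖y‖ ≤ 1 →
      ‖(2⁻¹ : ℝ) • (x + y)‖ ≤ 1 - cv * ‖x - y‖ ^ p)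
    (hη0 : 0 < η) (hη1 : η * 6 ^ (p - 1) * 100 ^ p ≤ 2 * cv) (hη2 : η ≤ 1 / (100 * 2 ^ 15))
    {F : ℝ → X} {K : ℝ≥0} (hF : LipschitzWith K F) {r δ : ℝ} (hr : 0 < r)
    {P : Set ℝ} {𝒰 : Finset (Set X)} (hδ : δ ≤ r / 2 ^ 15 / 1000)
    (hP : IsFinePartition F δ P) (h𝒰 : IsFineCover (F '' Icc 0 1) δ 𝒰)
    {Y : Finset X} (hY : IsSparse F r Y) :
    ∑ y ∈ Y, bend F p y r ≤ 1 / 2 * bendSum F p (r / 2 ^ 15) +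
      1 / η * ((eVariationOn F P).toReal - pathContent F (16 * r)) +
      2 ^ 20 * (∑ U ∈ 𝒰, diam U - setContent (F '' Icc 0 1) (16 * r)) := by
  set s := r / 2 ^ 15 with hs
  have hsr : r = 2 ^ 15 * s := by rw [hs]; ring
  have hs0 : 0 < s := by positivity
  let QA : X → Prop := fun y => ∃ z ∈ F '' Icc 0 1, dist z y ≤ r ∧
    lineDev (F '' Icc 0 1 ∩ closedBall y r) / 100 ≤ lineDev (F '' Icc 0 1 ∩ closedBall z s)
  let QB : X → Prop := fun y => ∃ a t b : ℝ, a ∈ P ∧ t ∈ P ∧ b ∈ P ∧ a ≤ t ∧ t ≤ b ∧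
    F '' Icc a b ⊆ closedBall y (3 * r) ∧
    η * bend F p y r ≤ dist (F a) (F t) + dist (F t) (F b) - dist (F a) (F b)
  let QC : X → Prop := fun y => ∃ 𝒱 : Finset (Set X), 𝒱 ⊆ 𝒰 ∧
    (∀ U ∈ 𝒱, U ⊆ closedBall y (3 * r)) ∧ diam (⋃ U ∈ 𝒱, U) ≤ 6 * r ∧
      s / 32 ≤ ∑ U ∈ 𝒱, diam U - diam (⋃ U ∈ 𝒱, U)
  have htri : ∀ y ∈ Y, QA y ∨ QB y ∨ QC y := by
    intro y hy
    obtain ⟨hyΓ, hy0, hy1⟩ := hY.1 y hy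
    rcases local_trichotomy hp hcv huc hη0 hη1 hη2 hF.continuous hr hyΓ hy0 hy1 hδ hP h𝒰 rfl with
      h | ⟨a, ha, t, ht, b, hb, h⟩ | ⟨𝒱, h𝒱, h⟩
    · exact Or.inl h
    · exact Or.inr (Or.inl ⟨a, t, b, ha, ht, hb, h⟩)
    · exact Or.inr (Or.inr ⟨𝒱, h𝒱, h⟩)
  have hA : ∑ y ∈ Y with QA y, bend F p y r ≤ 1 / 2 * bendSum F p s := by
    have hQ : ∀ y, QA y → QA y := fun _ h => h
    choose! z hzΓ hzy hzd using hQ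
    have hmem : ∀ y ∈ Y.filter QA, y ∈ Y ∧ QA y := fun y hy => Finset.mem_filter.1 hy
    have hzsep : ∀ y ∈ Y.filter QA, ∀ y' ∈ Y.filter QA, y ≠ y' → 6 * s < dist (z y) (z y') := by
      intro y hy y' hy' hne
      have h1 := hY.2 y (hmem y hy).1 y' (hmem y' hy').1 hne
      have h2 := hzy y (hmem y hy).2
      have h3 := hzy y' (hmem y' hy').2
      have h4 := dist_triangle4 y (z y) (z y') y'
      rw [dist_comm y (z y)] at h4
      linarith
    have hinj : Set.InjOn z (Y.filter QA) := by
      intro y hy y' hy' h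
      by_contra hne
      have := hzsep y hy y' hy' hne
      rw [h, dist_self] at this
      linarith
    have hsparse : IsSparse F s ((Y.filter QA).image z) := by
      refine ⟨fun w hw => ?_, fun w hw w' hw' hne => ?_⟩
      · obtain ⟨y, hy, rfl⟩ := Finset.mem_image.1 hw
        obtain ⟨hyY, hyQ⟩ := hmem y hy
        obtain ⟨-, h0, h1⟩ := hY.1 y hyY
        have h2 := hzy y hyQ
        have h3 := dist_triangle_left y (F 0) (z y)
        have h4 := dist_triangle_left y (F 1) (z y)
        exact ⟨hzΓ y hyQ, by linarith, by linarith⟩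
      · obtain ⟨y, hy, rfl⟩ := Finset.mem_image.1 hw
        obtain ⟨y', hy', rfl⟩ := Finset.mem_image.1 hw'
        exact hzsep y hy y' hy' fun h => hne (h ▸ rfl)
    have hsum := sum_bend_le_bendSum hF (by linarith : 0 ≤ p) hs0 hsparse
    rw [Finset.sum_image hinj] at hsum
    refine le_trans ?_ (mul_le_mul_of_nonneg_left hsum (by norm_num))
    rw [Finset.mul_sum]
    refine Finset.sum_le_sum fun y hy => ?_
    have hd := hzd y (hmem y hy).2
    have h0 := lineDev_nonneg (F '' Icc 0 1 ∩ closedBall y r)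
    have h0' := lineDev_nonneg (F '' Icc 0 1 ∩ closedBall (z y) s)
    unfold bend
    calc lineDev (F '' Icc 0 1 ∩ closedBall y r) ^ p * r ^ (1 - p)
        ≤ (100 * lineDev (F '' Icc 0 1 ∩ closedBall (z y) s)) ^ p * (2 ^ 15 * s) ^ (1 - p) := by
          rw [← hsr]
          gcongr
          linarith
      _ = 100 ^ p * (2 ^ 15) ^ (1 - p) *
          (lineDev (F '' Icc 0 1 ∩ closedBall (z y) s) ^ p * s ^ (1 - p)) := by
          rw [Real.mul_rpow (by norm_num) h0', Real.mul_rpow (by positivity) hs0.le]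
          ring
      _ ≤ 1 / 2 * (lineDev (F '' Icc 0 1 ∩ closedBall (z y) s) ^ p * s ^ (1 - p)) :=
          mul_le_mul_of_nonneg_right (hundred_rpow_mul_le hp) (by positivity)
  have hfar : ∀ y ∈ Y, ∀ y' ∈ Y, y ≠ y' →
      Disjoint (closedBall y (3 * r)) (closedBall y' (3 * r)) := by
    intro y hy y' hy' hne
    exact closedBall_disjoint_closedBall (by linarith [hY.2 y hy y' hy' hne])
  have hB : ∑ y ∈ Y with QB y, bend F p y r ≤
      1 / η * ((eVariationOn F P).toReal - pathContent F (16 * r)) := by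
    have hQ : ∀ y, QB y → QB y := fun _ h => h
    choose! a t b ha ht hb hat htb hball hexc using hQ
    have hmem : ∀ y ∈ Y.filter QB, y ∈ Y ∧ QB y := fun y hy => Finset.mem_filter.1 hy
    have h := pathContent_add_sum_le hF (by linarith : δ ≤ 16 * r) hP (Y.filter QB) a t b
      (fun y hy => ha y (hmem y hy).2) (fun y hy => ht y (hmem y hy).2)
      (fun y hy => hb y (hmem y hy).2) (fun y hy => hat y (hmem y hy).2)
      (fun y hy => htb y (hmem y hy).2)
      (fun y hy y' hy' hne => Set.disjoint_left.2 fun τ hτ hτ' =>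
        Set.disjoint_left.1 (hfar y (hmem y hy).1 y' (hmem y' hy').1 hne)
          (hball y (hmem y hy).2 ⟨τ, hτ, rfl⟩) (hball y' (hmem y' hy').2 ⟨τ, hτ', rfl⟩))
      (fun y hy x hx x' hx' => by
        have h1 := mem_closedBall.1 (hball y (hmem y hy).2 ⟨x, hx, rfl⟩)
        have h2 := mem_closedBall.1 (hball y (hmem y hy).2 ⟨x', hx', rfl⟩)
        have h3 := dist_triangle_right (F x) (F x') y
        linarith)
    have h2 : η * ∑ y ∈ Y with QB y, bend F p y r ≤ ∑ y ∈ Y with QB y,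
        (dist (F (a y)) (F (t y)) + dist (F (t y)) (F (b y)) - dist (F (a y)) (F (b y))) := by
      rw [Finset.mul_sum]
      exact Finset.sum_le_sum fun y hy => hexc y (hmem y hy).2
    rw [div_mul_eq_mul_div, one_mul, le_div_iff₀ hη0]
    linarith
  have hC : ∑ y ∈ Y with QC y, bend F p y r ≤
      2 ^ 20 * (∑ U ∈ 𝒰, diam U - setContent (F '' Icc 0 1) (16 * r)) := by
    have hQ : ∀ y, QC y → QC y := fun _ h => h
    choose! 𝒱 h𝒱 hball hdiam hgain using hQ
    have hmem : ∀ y ∈ Y.filter QC, y ∈ Y ∧ QC y := fun y hy => Finset.mem_filter.1 hy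
    have hsel : ∀ y ∈ Y.filter QC, (𝒱 y).filter (fun U => U.Nonempty) ⊆ 𝒱 y :=
      fun y _ => Finset.filter_subset _ _
    have hsumsel : ∀ y, ∑ U ∈ (𝒱 y).filter (fun U => U.Nonempty), diam U = ∑ U ∈ 𝒱 y, diam U := by
      intro y
      refine Finset.sum_filter_of_ne fun U _ hU => ?_
      by_contra hne
      rw [Set.not_nonempty_iff_eq_empty] at hne
      exact hU (by rw [hne, diam_empty])
    have hunsel : ∀ y ∈ Y.filter QC,
        diam (⋃ U ∈ (𝒱 y).filter (fun U => U.Nonempty), U) ≤ diam (⋃ U ∈ 𝒱 y, U) := by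
      intro y hy
      refine diam_mono (biUnion_subset_biUnion_left (hsel y hy)) ?_
      exact isBounded_closedBall.subset (iUnion₂_subset (hball y (hmem y hy).2))
    have h := setContent_add_sum_le (by linarith : δ ≤ 16 * r) h𝒰 (Y.filter QC)
      (fun y => (𝒱 y).filter (fun U => U.Nonempty))
      (fun y hy => (hsel y hy).trans (h𝒱 y (hmem y hy).2))
      (fun y hy y' hy' hne => Finset.disjoint_left.2 fun U hU hU' => by
        obtain ⟨hU, x, hx⟩ := Finset.mem_filter.1 hU
        exact Set.disjoint_left.1 (hfar y (hmem y hy).1 y' (hmem y' hy').1 hne)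
          (hball y (hmem y hy).2 U hU hx)
          (hball y' (hmem y' hy').2 U (Finset.mem_filter.1 hU').1 hx))
      (fun y hy => (hunsel y hy).trans ((hdiam y (hmem y hy).2).trans (by linarith)))
    have h2 : ∑ y ∈ Y with QC y, bend F p y r ≤ ∑ y ∈ Y with QC y, 2 ^ 20 *
        (∑ U ∈ (𝒱 y).filter (fun U => U.Nonempty), diam U -
          diam (⋃ U ∈ (𝒱 y).filter (fun U => U.Nonempty), U)) := by
      refine Finset.sum_le_sum fun y hy => ?_
      have h3 := hgain y (hmem y hy).2
      have h4 := bend_le F (by linarith : 0 ≤ p) y hr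
      have h5 := hunsel y hy
      rw [hsumsel]
      linarith
    rw [← Finset.mul_sum] at h2
    linarith
  have hpos : ∀ y ∈ Y, 0 ≤ bend F p y r := fun y _ => bend_nonneg F p y hr
  have hsplit : ∑ y ∈ Y, bend F p y r ≤ ∑ y ∈ Y with QA y, bend F p y r +
      ∑ y ∈ Y with QB y, bend F p y r + ∑ y ∈ Y with QC y, bend F p y r := by
    rw [Finset.sum_filter, Finset.sum_filter, Finset.sum_filter, ← Finset.sum_add_distrib,
      ← Finset.sum_add_distrib]
    refine Finset.sum_le_sum fun y hy => ?_
    have h0 := hpos y hy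
    rcases htri y hy with h | h | h <;> rw [if_pos h] <;> split_ifs <;> linarith
  linarith

/-- The total bending at scale `r` is controlled by half the total bending at a smaller scale
and the growth of the contents between the two scales. -/
theorem bendSum_le_half_add [Nontrivial X] {p cv η : ℝ} (hp : 2 ≤ p) (hcv : 0 < cv)
    (huc : ∀ x y : X, ‖x‖ ≤ 1 → ‖y‖ ≤ 1 →
      ‖(2⁻¹ : ℝ) • (x + y)‖ ≤ 1 - cv * ‖x - y‖ ^ p)
    (hη0 : 0 < η) (hη1 : η * 6 ^ (p - 1) * 100 ^ p ≤ 2 * cv) (hη2 : η ≤ 1 / (100 * 2 ^ 15))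
    {F : ℝ → X} {K : ℝ≥0} (hF : LipschitzWith K F) {r δ : ℝ} (hr : 0 < r) (hδ0 : 0 < δ)
    (hδ : δ ≤ r / 2 ^ 15 / 1000) :
    bendSum F p r ≤ 1 / 2 * bendSum F p (r / 2 ^ 15) +
      1 / η * (pathContent F δ - pathContent F (16 * r)) +
      2 ^ 20 * (setContent (F '' Icc 0 1) δ - setContent (F '' Icc 0 1) (16 * r)) := by
  refine bendSum_le fun Y hY => ?_
  have h1 : ∀ 𝒰, IsFineCover (F '' Icc 0 1) δ 𝒰 → ∑ y ∈ Y, bend F p y r ≤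
      1 / 2 * bendSum F p (r / 2 ^ 15) + 1 / η * (pathContent F δ - pathContent F (16 * r)) +
      2 ^ 20 * (∑ U ∈ 𝒰, diam U - setContent (F '' Icc 0 1) (16 * r)) := by
    intro 𝒰 h𝒰
    have h2 : η * (∑ y ∈ Y, bend F p y r - 1 / 2 * bendSum F p (r / 2 ^ 15) -
        2 ^ 20 * (∑ U ∈ 𝒰, diam U - setContent (F '' Icc 0 1) (16 * r))) +
        pathContent F (16 * r) ≤ pathContent F δ := by
      refine le_csInf ⟨_, _, isFinePartition_Icc F hδ0.le, rfl⟩ ?_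
      rintro _ ⟨P, hP, rfl⟩
      have h3 := sum_bend_le_of_isFine hp hcv huc hη0 hη1 hη2 hF hr hδ hP h𝒰 hY
      have h4 : ∑ y ∈ Y, bend F p y r - 1 / 2 * bendSum F p (r / 2 ^ 15) -
        2 ^ 20 * (∑ U ∈ 𝒰, diam U - setContent (F '' Icc 0 1) (16 * r)) ≤
        ((eVariationOn F P).toReal - pathContent F (16 * r)) / η := by
        rw [← one_div_mul_eq_div η]
        linarith
      rw [le_div_iff₀ hη0] at h4
      dsimp only
      linarith
    have h5 : ∑ y ∈ Y, bend F p y r - 1 / 2 * bendSum F p (r / 2 ^ 15) -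
        2 ^ 20 * (∑ U ∈ 𝒰, diam U - setContent (F '' Icc 0 1) (16 * r)) ≤
        (pathContent F δ - pathContent F (16 * r)) / η := by
      rw [le_div_iff₀ hη0]
      linarith
    rw [← one_div_mul_eq_div η] at h5
    linarith
  obtain ⟨𝒰₀, h𝒰₀, -⟩ := exists_isFineCover hF hδ0
  have h6 : (∑ y ∈ Y, bend F p y r - 1 / 2 * bendSum F p (r / 2 ^ 15) -
      1 / η * (pathContent F δ - pathContent F (16 * r))) / 2 ^ 20 +
      setContent (F '' Icc 0 1) (16 * r) ≤ setContent (F '' Icc 0 1) δ := by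
    refine le_csInf ⟨_, _, h𝒰₀, rfl⟩ ?_
    rintro _ ⟨𝒰, h𝒰, rfl⟩
    have := h1 𝒰 h𝒰
    dsimp only
    linarith
  linarith

end Scales

section Telescoping

lemma sum_range_add_le {T : ℕ → ℝ} {B : ℝ} (h0 : ∀ i, 0 ≤ T i) (hB : ∀ i, T i ≤ B) (m N : ℕ) :
    ∑ i ∈ Finset.range N, T (i + m) ≤ ∑ i ∈ Finset.range N, T i + m * B := by
  have h1 := Finset.sum_range_add T m N
  have h2 := Finset.sum_range_add T N m
  rw [add_comm m N] at h1
  have h3 : ∑ i ∈ Finset.range m, T (N + i) ≤ m * B := by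
    simpa using Finset.sum_le_sum fun i (_ : i ∈ Finset.range m) => hB (N + i)
  have h4 : 0 ≤ ∑ i ∈ Finset.range m, T i := Finset.sum_nonneg fun i _ => h0 i
  simp_rw [add_comm _ m]
  linarith

lemma sum_range_le_of_le_half_add {S T : ℕ → ℝ} {L B : ℝ} (hS0 : ∀ i, 0 ≤ S i)
    (hSL : ∀ i, S i ≤ L) (hT0 : ∀ i, 0 ≤ T i) (hTB : ∀ i, T i ≤ B) (a b : ℕ)
    (h : ∀ i, S i ≤ 1 / 2 * S (i + a) + (T (i + b) - T i)) (N : ℕ) :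
    ∑ i ∈ Finset.range N, S i ≤ a * L + 2 * b * B := by
  have h1 := Finset.sum_le_sum fun i (_ : i ∈ Finset.range N) => h i
  rw [Finset.sum_add_distrib, Finset.sum_sub_distrib, ← Finset.mul_sum] at h1
  linarith [sum_range_add_le hS0 hSL a N, sum_range_add_le hT0 hTB b N]

variable {X : Type u} [NormedAddCommGroup X] [NormedSpace ℝ X]

/-- The total bending of sparse families, summed over dyadic scales, is at most a multiple of the
Lipschitz constant of the path. -/
theorem sum_bendSum_le [Nontrivial X] {p cv η : ℝ} (hp : 2 ≤ p) (hcv : 0 < cv)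
    (huc : ∀ x y : X, ‖x‖ ≤ 1 → ‖y‖ ≤ 1 →
      ‖(2⁻¹ : ℝ) • (x + y)‖ ≤ 1 - cv * ‖x - y‖ ^ p)
    (hη0 : 0 < η) (hη1 : η * 6 ^ (p - 1) * 100 ^ p ≤ 2 * cv) (hη2 : η ≤ 1 / (100 * 2 ^ 15))
    {F : ℝ → X} {K : ℝ≥0} (hF : LipschitzWith K F) {r : ℝ} (hr : 0 < r) (N : ℕ) :
    ∑ i ∈ Finset.range N, bendSum F p (r / 2 ^ i) ≤ (15 + 58 * (1 / η + 2 ^ 20)) * K := by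
  have hp0 : 0 ≤ p := by linarith
  have key := sum_range_le_of_le_half_add (S := fun i => bendSum F p (r / 2 ^ i))
    (T := fun i => 1 / η * pathContent F (16 * (r / 2 ^ i)) +
      2 ^ 20 * setContent (F '' Icc 0 1) (16 * (r / 2 ^ i)))
    (L := K) (B := (1 / η + 2 ^ 20) * K)
    (fun i => bendSum_nonneg hF hp0 (by positivity))
    (fun i => bendSum_le fun Y hY => sum_bend_le_of_isSparse hF hp0 (by positivity) hY)
    (fun i => by
      have h1 := pathContent_nonneg F (16 * (r / 2 ^ i))
      have h2 := setContent_nonneg (F '' Icc 0 1) (16 * (r / 2 ^ i))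
      positivity)
    (fun i => by
      have h1 := pathContent_le_of_lipschitzWith hF (by positivity : 0 < 16 * (r / 2 ^ i))
      have h2 := setContent_le_of_lipschitzWith hF (by positivity : 0 < 16 * (r / 2 ^ i))
      have h3 := mul_le_mul_of_nonneg_left h1 (by positivity : 0 ≤ 1 / η)
      linarith) 15 29
    (fun i => by
      have h := bendSum_le_half_add hp hcv huc hη0 hη1 hη2 hF
        (by positivity : 0 < r / 2 ^ i) (by positivity : 0 < 16 * (r / 2 ^ (i + 29))) (by
          have h1 : 0 < r / 2 ^ i := by positivity
          rw [pow_add, ← div_div]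
          linarith)
      rw [div_div, ← pow_add] at h
      linarith) N
  refine key.trans (le_of_eq ?_)
  push_cast
  ring

end Telescoping

section Crowding

lemma exists_separated_subset {M : Type*} [PseudoMetricSpace M] (w : M → ℝ) {ρ : ℝ} (hρ : 0 ≤ ρ)
    (Y : Finset M) : ∃ Y' ⊆ Y, (∀ y ∈ Y', ∀ y' ∈ Y', y ≠ y' → ρ < dist y y') ∧
      ∀ x ∈ Y, ∃ y ∈ Y', dist x y ≤ ρ ∧ w x ≤ w y := by
  induction Y using Finset.strongInduction with
  | H Y ih =>
    rcases Y.eq_empty_or_nonempty with rfl | hne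
    · exact ⟨∅, by simp⟩
    obtain ⟨y₀, hy₀, hmax⟩ := Y.exists_max_image w hne
    obtain ⟨Z, hZ, hsep, hcov⟩ := ih (Y.filter fun x => ρ < dist x y₀)
      (Finset.filter_ssubset.2 ⟨y₀, hy₀, by simpa using hρ⟩)
    have hZ' : ∀ z ∈ Z, ρ < dist z y₀ := fun z hz => (Finset.mem_filter.1 (hZ hz)).2
    refine ⟨insert y₀ Z, ?_, ?_, ?_⟩
    · exact Finset.insert_subset hy₀ (hZ.trans (Finset.filter_subset _ _))
    · intro y hy y' hy' hyy'
      rcases Finset.mem_insert.1 hy with rfl | hyZ <;> rcases Finset.mem_insert.1 hy' with rfl | hyZ'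
      · exact absurd rfl hyy'
      · rw [dist_comm]
        exact hZ' y' hyZ'
      · exact hZ' y hyZ
      · exact hsep y hyZ y' hyZ' hyy'
    · intro x hx
      rcases le_or_gt (dist x y₀) ρ with h | h
      · exact ⟨y₀, Finset.mem_insert_self _ _, h, hmax x hx⟩
      · obtain ⟨y, hy, h⟩ := hcov x (Finset.mem_filter.2 ⟨hx, h⟩)
        exact ⟨y, Finset.mem_insert_of_mem hy, h⟩

variable {X : Type u} [NormedAddCommGroup X] [NormedSpace ℝ X]

lemma sum_bend_le_of_isFineCover [Nontrivial X] {F : ℝ → X} {K : ℝ≥0} (hF : LipschitzWith K F)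
    {p A r δ : ℝ} (hp : 0 ≤ p) (hA : 1 < A) (hr : 0 < r) (hδ : δ ≤ r / A / 8)
    {𝒰 : Finset (Set X)} (h𝒰 : IsFineCover (F '' Icc 0 1) δ 𝒰) {Y : Finset X}
    (hY : ∀ y ∈ Y, y ∈ pathCore F r) (hsep : ∀ y ∈ Y, ∀ y' ∈ Y, y ≠ y' → r / A ≤ dist y y') :
    ∑ y ∈ Y, bend F p y r ≤ 112 * A * bendSum F p r +
      8 * A * (∑ U ∈ 𝒰, diam U - setContent (F '' Icc 0 1) (16 * r)) := by
  have hA0 : 0 < A := by linarith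
  obtain ⟨q, hq⟩ : ∃ q, q = r / A := ⟨_, rfl⟩
  have hq0 : 0 < q := hq ▸ by positivity
  have hrq : r = A * q := by rw [hq]; field_simp
  have hqr : q ≤ r := by nlinarith
  rw [← hq] at hδ hsep
  obtain ⟨Y', hY'Y, hY'sep, hcov⟩ :=
    exists_separated_subset (fun y => bend F p y r) (by positivity : 0 ≤ 6 * r) Y
  have hsparse : IsSparse F r Y' := ⟨fun y hy => hY y (hY'Y hy), hY'sep⟩
  choose! c hcY' hcd hcw using hcov
  let C : X → Finset X := fun y => {x ∈ Y | c x = y}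
  have hCmem : ∀ {x y}, x ∈ C y → x ∈ Y ∧ c x = y := fun h => Finset.mem_filter.1 h
  let 𝒱 : X → Finset (Set X) := fun y =>
    {U ∈ 𝒰 | ∃ x ∈ C y, (U ∩ closedBall x (q / 4)).Nonempty}
  have hball : ∀ y, ∀ U ∈ 𝒱 y, U ⊆ closedBall y (7 * r) := by
    intro y U hU
    obtain ⟨hU𝒰, x, hx, hUx⟩ := Finset.mem_filter.1 hU
    obtain ⟨hxY, rfl⟩ := hCmem hx
    refine (subset_closedBall_of_inter_nonempty (h𝒰.bounded U hU𝒰) (h𝒰.diam_le U hU𝒰) hUx).trans ?_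
    refine closedBall_subset_closedBall' ?_
    linarith [hcd x hxY]
  have hdiam : ∀ y, diam (⋃ U ∈ 𝒱 y, U) ≤ 14 * r := by
    intro y
    refine (diam_mono (iUnion₂_subset (hball y)) isBounded_closedBall).trans ?_
    refine (diam_closedBall (by positivity)).trans (by linarith)
  have hcard : ∀ y, (C y).card * (q / 4) ≤ ∑ U ∈ 𝒱 y, diam U := by
    intro y
    refine card_mul_le_sum_diam_filter (isPreconnected_Icc.image F hF.continuous.continuousOn)
      h𝒰 (C y) (fun x hx => ?_) fun x hx x' hx' h => ?_
    · obtain ⟨hxΓ, hx0, -⟩ := hY x (hCmem hx).1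
      exact ⟨hxΓ, F 0, ⟨0, by simp, rfl⟩, by linarith⟩
    · linarith [hsep x (hCmem hx).1 x' (hCmem hx').1 h]
  have hgain := setContent_add_sum_le (by linarith : δ ≤ 16 * r) h𝒰
    (Y'.filter fun y => 112 * A ≤ (C y).card) 𝒱 (fun y _ => Finset.filter_subset _ _)
    (fun y _ y' _ hne => Finset.disjoint_left.2 fun U hU hU' => by
      obtain ⟨hU, x, hx, hUx⟩ := Finset.mem_filter.1 hU
      obtain ⟨-, x', hx', z, hzU, hzx'⟩ := Finset.mem_filter.1 hU'
      have h1 := subset_closedBall_of_inter_nonempty (h𝒰.bounded U hU) (h𝒰.diam_le U hU) hUx hzU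
      rw [mem_closedBall] at h1 hzx'
      have h2 := hsep x (hCmem hx).1 x' (hCmem hx').1
        (fun h => hne (by rw [← (hCmem hx).2, ← (hCmem hx').2, h]))
      linarith [dist_triangle_left x x' z])
    (fun y _ => (hdiam y).trans (by linarith))
  have hfib : ∑ y ∈ Y, bend F p y r = ∑ y ∈ Y', ∑ x ∈ C y, bend F p x r :=
    (Finset.sum_fiberwise_of_maps_to hcY' _).symm
  have hterm : ∀ y ∈ Y', ∑ x ∈ C y, bend F p x r ≤ 112 * A * bend F p y r +
      8 * A * (if 112 * A ≤ (C y).card then ∑ U ∈ 𝒱 y, diam U - diam (⋃ U ∈ 𝒱 y, U) else 0) := by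
    intro y hy
    have hb0 := bend_nonneg F p y hr
    split_ifs with h
    · have h1 : ∑ x ∈ C y, bend F p x r ≤ (C y).card * r := by
        simpa using Finset.sum_le_sum fun x (_ : x ∈ C y) => bend_le F hp x hr
      have h2 := hcard y
      have h3 := hdiam y
      have h4 : 112 * r ≤ (C y).card * q := by
        rw [hrq, ← mul_assoc]
        exact mul_le_mul_of_nonneg_right h hq0.le
      have h5 : (C y).card * r ≤
          8 * A * (∑ U ∈ 𝒱 y, diam U - diam (⋃ U ∈ 𝒱 y, U)) := by
        calc (C y).card * r = 8 * A * ((C y).card * q / 8) := by rw [hrq]; ring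
          _ ≤ _ := mul_le_mul_of_nonneg_left (by linarith) (by positivity)
      have h6 : 0 ≤ 112 * A * bend F p y r := by positivity
      linarith
    · have h1 : ∑ x ∈ C y, bend F p x r ≤ (C y).card * bend F p y r := by
        have := Finset.sum_le_sum fun x (hx : x ∈ C y) =>
          show bend F p x r ≤ bend F p y r by
            obtain ⟨hxY, rfl⟩ := hCmem hx
            exact hcw x hxY
        simpa using this
      have h2 := mul_le_mul_of_nonneg_right (not_le.1 h).le hb0
      linarith
  have hsum := Finset.sum_le_sum hterm
  rw [Finset.sum_add_distrib, ← Finset.mul_sum, ← Finset.mul_sum, ← Finset.sum_filter] at hsum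
  rw [hfib]
  have h1 := mul_le_mul_of_nonneg_left (sum_bend_le_bendSum hF hp hr hsparse)
    (by positivity : 0 ≤ 112 * A)
  have h2 := mul_le_mul_of_nonneg_left (le_sub_iff_add_le'.2 hgain) (by positivity : 0 ≤ 8 * A)
  linarith

/-- Total bending over families which are merely `r / A`-separated. -/
theorem sum_bend_le_of_separated [Nontrivial X] {F : ℝ → X} {K : ℝ≥0} (hF : LipschitzWith K F)
    {p A r δ : ℝ} (hp : 0 ≤ p) (hA : 1 < A) (hr : 0 < r) (hδ0 : 0 < δ) (hδ : δ ≤ r / A / 8)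
    {Y : Finset X} (hY : ∀ y ∈ Y, y ∈ pathCore F r)
    (hsep : ∀ y ∈ Y, ∀ y' ∈ Y, y ≠ y' → r / A ≤ dist y y') :
    ∑ y ∈ Y, bend F p y r ≤ 112 * A * bendSum F p r +
      8 * A * (setContent (F '' Icc 0 1) δ - setContent (F '' Icc 0 1) (16 * r)) := by
  have hA0 : 0 < 8 * A := by linarith
  obtain ⟨𝒰₀, h𝒰₀, -⟩ := exists_isFineCover hF hδ0
  have h : (∑ y ∈ Y, bend F p y r - 112 * A * bendSum F p r) / (8 * A) +
      setContent (F '' Icc 0 1) (16 * r) ≤ setContent (F '' Icc 0 1) δ := by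
    refine le_csInf ⟨_, _, h𝒰₀, rfl⟩ ?_
    rintro _ ⟨𝒰, h𝒰, rfl⟩
    have := sum_bend_le_of_isFineCover hF hp hA hr hδ h𝒰 hY hsep
    dsimp only
    rw [← le_sub_iff_add_le, div_le_iff₀ hA0]
    linarith
  rw [← le_sub_iff_add_le, div_le_iff₀ hA0] at h
  linarith

/-- An upper bound for the total bending of `r / A`-separated families, which is summable over
dyadic scales. -/
def separatedBound (F : ℝ → X) (p A : ℝ) (m : ℕ) (r : ℝ) : ℝ :=
  112 * A * bendSum F p r +
    8 * A * (setContent (F '' Icc 0 1) (16 * (r / 2 ^ m)) - setContent (F '' Icc 0 1) (16 * r))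

lemma sum_bend_le_separatedBound [Nontrivial X] {F : ℝ → X} {K : ℝ≥0} (hF : LipschitzWith K F)
    {p A r : ℝ} {m : ℕ} (hp : 0 ≤ p) (hA : 1 < A) (hm : 128 * A ≤ 2 ^ m) (hr : 0 < r)
    {Y : Finset X} (hY : ∀ y ∈ Y, y ∈ pathCore F r)
    (hsep : ∀ y ∈ Y, ∀ y' ∈ Y, y ≠ y' → r / A ≤ dist y y') :
    ∑ y ∈ Y, bend F p y r ≤ separatedBound F p A m r := by
  have hA0 : 0 < A := by linarith
  refine sum_bend_le_of_separated hF hp hA hr (by positivity) ?_ hY hsep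
  calc 16 * (r / 2 ^ m) ≤ 16 * (r / (128 * A)) := by gcongr
    _ = r / A / 8 := by field_simp; norm_num

lemma separatedBound_nonneg [Nontrivial X] {F : ℝ → X} {K : ℝ≥0} (hF : LipschitzWith K F)
    {p A r : ℝ} {m : ℕ} (hp : 0 ≤ p) (hA : 1 < A) (hm : 128 * A ≤ 2 ^ m) (hr : 0 < r) :
    0 ≤ separatedBound F p A m r := by
  simpa using sum_bend_le_separatedBound hF hp hA hm hr (Y := ∅) (by simp) (by simp)

lemma sum_separatedBound_le [Nontrivial X] {p cv η : ℝ} (hp : 2 ≤ p) (hcv : 0 < cv)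
    (huc : ∀ x y : X, ‖x‖ ≤ 1 → ‖y‖ ≤ 1 →
      ‖(2⁻¹ : ℝ) • (x + y)‖ ≤ 1 - cv * ‖x - y‖ ^ p)
    (hη0 : 0 < η) (hη1 : η * 6 ^ (p - 1) * 100 ^ p ≤ 2 * cv) (hη2 : η ≤ 1 / (100 * 2 ^ 15))
    {F : ℝ → X} {K : ℝ≥0} (hF : LipschitzWith K F) {A r : ℝ} (m : ℕ) (hA : 1 < A) (hr : 0 < r)
    (N : ℕ) :
    ∑ i ∈ Finset.range N, separatedBound F p A m (r / 2 ^ i) ≤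
      A * (112 * (15 + 58 * (1 / η + 2 ^ 20)) + 8 * m) * K := by
  have hA0 : 0 < A := by linarith
  have h1 := mul_le_mul_of_nonneg_left
    (sum_bendSum_le hp hcv huc hη0 hη1 hη2 hF hr N) (by positivity : 0 ≤ 112 * A)
  have h2 := sum_range_add_le (T := fun i => setContent (F '' Icc 0 1) (16 * (r / 2 ^ i)))
    (fun i => setContent_nonneg _ _)
    (fun i => setContent_le_of_lipschitzWith hF (by positivity)) m N
  have h3 := mul_le_mul_of_nonneg_left (sub_le_iff_le_add'.2 h2) (by positivity : 0 ≤ 8 * A)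
  simp_rw [pow_add, ← div_div] at h3
  unfold separatedBound
  rw [Finset.sum_add_distrib, ← Finset.mul_sum, ← Finset.mul_sum, Finset.sum_sub_distrib]
  linarith

end Crowding

section Extension

variable {X : Type u} [NormedAddCommGroup X] [NormedSpace ℝ X]

/-- A Lipschitz curve can be prolonged by two segments so that its new end points are far away
from the original curve. -/
lemma exists_extended_path [Nontrivial X] {Γ : Set X} (hΓ : IsBounded Γ) {f : ℝ → X} {L D : ℝ}
    (hL : 0 ≤ L) (hD : 0 ≤ D) (hf : f '' Icc 0 1 = Γ)
    (hlip : ∀ s ∈ Icc (0 : ℝ) 1, ∀ t ∈ Icc (0 : ℝ) 1, dist (f s) (f t) ≤ L * |s - t|) :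
    ∃ F : ℝ → X, LipschitzWith (3 * L + 6 * D).toNNReal F ∧ Γ ⊆ F '' Icc 0 1 ∧
      ∀ x ∈ Γ, D - diam Γ ≤ dist x (F 0) ∧ D - diam Γ ≤ dist x (F 1) := by
  obtain ⟨e, he⟩ := exists_norm_eq X zero_le_one
  let c : ℝ → ℝ := fun t => projIcc 0 1 zero_le_one (3 * t - 1)
  let g : ℝ → ℝ := fun t => max (1 - 3 * t) 0 + max (3 * t - 2) 0
  have hc : ∀ t, c t ∈ Icc (0 : ℝ) 1 := fun t => (projIcc 0 1 zero_le_one (3 * t - 1)).2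
  have hcc : ∀ s t, |c s - c t| ≤ 3 * |s - t| := by
    intro s t
    have := (LipschitzWith.projIcc (zero_le_one' ℝ)).dist_le_mul (3 * s - 1) (3 * t - 1)
    rw [Subtype.dist_eq, Real.dist_eq, Real.dist_eq] at this
    refine this.trans (le_of_eq ?_)
    rw [show 3 * s - 1 - (3 * t - 1) = 3 * (s - t) by ring, abs_mul]
    simp
  have hgg : ∀ s t, |g s - g t| ≤ 6 * |s - t| := by
    intro s t
    have h1 := abs_max_sub_max_le_abs (1 - 3 * s) (1 - 3 * t) 0
    have h2 := abs_max_sub_max_le_abs (3 * s - 2) (3 * t - 2) 0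
    rw [show 1 - 3 * s - (1 - 3 * t) = -3 * (s - t) by ring, abs_mul] at h1
    rw [show 3 * s - 2 - (3 * t - 2) = 3 * (s - t) by ring, abs_mul] at h2
    norm_num at h1 h2
    calc |g s - g t| = |(max (1 - 3 * s) 0 - max (1 - 3 * t) 0) +
        (max (3 * s - 2) 0 - max (3 * t - 2) 0)| := by congr 1; simp only [g]; ring
      _ ≤ _ := abs_add_le _ _
      _ ≤ _ := by linarith
  have hg0 : g 0 = 1 := by norm_num [g]
  have hg1 : g 1 = 1 := by norm_num [g]
  have hfar : ∀ x ∈ Γ, ∀ t, g t = 1 → D - diam Γ ≤ dist x (f (c t) + (D * g t) • e) := by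
    intro x hx t ht
    have h1 := dist_le_diam_of_mem hΓ hx (hf ▸ ⟨c t, hc t, rfl⟩ : f (c t) ∈ Γ)
    have h2 := dist_triangle_left (f (c t) + (D * g t) • e) (f (c t)) x
    have h3 : dist (f (c t) + (D * g t) • e) (f (c t)) = D := by
      rw [dist_eq_norm, add_sub_cancel_left, ht, norm_smul, he, Real.norm_eq_abs, mul_one,
        mul_one, abs_of_nonneg hD]
    linarith
  refine ⟨fun t => f (c t) + (D * g t) • e, ?_, ?_, fun x hx =>
    ⟨hfar x hx 0 hg0, hfar x hx 1 hg1⟩⟩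
  · refine LipschitzWith.of_dist_le_mul fun s t => ?_
    rw [Real.coe_toNNReal _ (by positivity), Real.dist_eq]
    have h1 := (hlip _ (hc s) _ (hc t)).trans (mul_le_mul_of_nonneg_left (hcc s t) hL)
    have h2 : dist ((D * g s) • e) ((D * g t) • e) ≤ D * (6 * |s - t|) := by
      rw [dist_eq_norm, ← sub_smul, ← mul_sub, norm_smul, he, mul_one, Real.norm_eq_abs, abs_mul,
        abs_of_nonneg hD]
      exact mul_le_mul_of_nonneg_left (hgg s t) hD
    have h3 := dist_add_add_le (f (c s)) ((D * g s) • e) (f (c t)) ((D * g t) • e)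
    linarith
  · rw [← hf]
    rintro _ ⟨s, hs, rfl⟩
    refine ⟨(s + 1) / 3, ⟨by linarith [hs.1], by linarith [hs.2]⟩, ?_⟩
    have h1 : c ((s + 1) / 3) = s := by
      simp only [c]
      rw [show 3 * ((s + 1) / 3) - 1 = s by ring, projIcc_of_mem _ hs]
    have h2 : g ((s + 1) / 3) = 0 := by
      simp only [g]
      rw [max_eq_right (by linarith [hs.1]), max_eq_right (by linarith [hs.2]), add_zero]
    simp only [h1, h2, mul_zero, zero_smul, add_zero]

end Extension

section BetaSum

lemma sSup_infDist_div_nonneg {M : Type*} [PseudoMetricSpace M] (S L Q : Set M) :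
    0 ≤ sSup ((fun x => infDist x L / diam Q) '' S) := by
  refine Real.sSup_nonneg ?_
  rintro _ ⟨x, -, rfl⟩
  exact div_nonneg infDist_nonneg diam_nonneg

variable {X : Type u} [NormedAddCommGroup X] [NormedSpace ℝ X]

lemma jonesBeta_nonneg (E Q : Set X) : 0 ≤ jonesBeta E Q := by
  unfold jonesBeta
  split_ifs
  · exact le_rfl
  · refine Real.sInf_nonneg ?_
    rintro _ ⟨a, v, -, rfl⟩
    exact sSup_infDist_div_nonneg _ _ _

lemma jonesBeta_le {E Q : Set X} {h : ℝ} (h0 : 0 ≤ h) (hEQ : IsNearLine (E ∩ Q) h) :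
    jonesBeta E Q ≤ h / diam Q := by
  unfold jonesBeta
  split_ifs
  · positivity
  · obtain ⟨a, v, hv, hline⟩ := hEQ
    refine le_trans (csInf_le ⟨0, ?_⟩ ⟨a, v, hv, rfl⟩) (Real.sSup_le ?_ (by positivity))
    · rintro _ ⟨a, v, -, rfl⟩
      exact sSup_infDist_div_nonneg _ _ _
    · rintro _ ⟨x, hx, rfl⟩
      obtain ⟨t, ht⟩ := hline x hx
      have h1 : infDist x (lineThrough a v) ≤ dist x (a + t • v) :=
        infDist_le_dist_of_mem (show a + t • v ∈ lineThrough a v from ⟨t, rfl⟩)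
      rw [dist_eq_norm] at h1
      exact div_le_div_of_nonneg_right (h1.trans ht) diam_nonneg

lemma jonesBeta_rpow_mul_diam_nonneg (E Q : Set X) (p : ℝ) : 0 ≤ jonesBeta E Q ^ p * diam Q :=
  mul_nonneg (Real.rpow_nonneg (jonesBeta_nonneg E Q) p) diam_nonneg

lemma jonesBeta_rpow_mul_diam_le_bend [Nontrivial X] {F : ℝ → X} {E : Set X}
    (hE : E ⊆ F '' Icc 0 1) {p : ℝ} (hp : 1 ≤ p) (y : X) {r : ℝ} (hr : 0 < r) :
    jonesBeta E (closedBall y r) ^ p * diam (closedBall y r) ≤ bend F p y r := by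
  have hd0 := lineDev_nonneg (F '' Icc 0 1 ∩ closedBall y r)
  have hd : jonesBeta E (closedBall y r) ≤
      lineDev (F '' Icc 0 1 ∩ closedBall y r) / (2 * r) := by
    rw [le_div_iff₀ (by positivity)]
    refine le_of_forall_gt_imp_ge_of_dense fun h hh => ?_
    have h1 := isNearLine_of_lineDev_lt (isBounded_closedBall.subset inter_subset_right) hh
    have h2 := jonesBeta_le (hd0.trans hh.le)
      (h1.mono (inter_subset_inter_left (closedBall y r) hE) le_rfl)
    rwa [diam_closedBall_eq _ hr.le, le_div_iff₀ (by positivity)] at h2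
  rw [diam_closedBall_eq _ hr.le]
  unfold bend
  calc jonesBeta E (closedBall y r) ^ p * (2 * r)
      ≤ (lineDev (F '' Icc 0 1 ∩ closedBall y r) / (2 * r)) ^ p * (2 * r) := by
        have := jonesBeta_nonneg E (closedBall y r)
        gcongr
    _ = lineDev (F '' Icc 0 1 ∩ closedBall y r) ^ p * (2 * r) ^ (1 - p) := by
        rw [Real.div_rpow hd0 (by positivity), Real.rpow_sub (by positivity), Real.rpow_one]
        ring
    _ ≤ _ := by
        refine mul_le_mul_of_nonneg_left ?_ (by positivity)
        exact Real.rpow_le_rpow_of_nonpos hr (by linarith) (by linarith)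

lemma jonesBeta_rpow_mul_diam_le_of_subset_closedBall [Nontrivial X] {E : Set X} {y : X}
    {d r p : ℝ} (hp : 2 ≤ p) (hd : 0 ≤ d) (hr : 0 < r) (hdr : d ≤ r) (hE : E ⊆ closedBall y d) :
    jonesBeta E (closedBall y r) ^ p * diam (closedBall y r) ≤ d * (d / r) := by
  have h1 : jonesBeta E (closedBall y r) ≤ d / (2 * r) := by
    have h := jonesBeta_le (E := E) (Q := closedBall y r) hd
      (isNearLine_of_subset_closedBall (inter_subset_left.trans hE))
    rwa [diam_closedBall_eq _ hr.le] at h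
  rw [diam_closedBall_eq _ hr.le]
  calc jonesBeta E (closedBall y r) ^ p * (2 * r)
      ≤ (d / (2 * r)) ^ p * (2 * r) := by
        have := jonesBeta_nonneg E (closedBall y r)
        gcongr
    _ ≤ (d / (2 * r)) ^ (2 : ℝ) * (2 * r) := by
        refine mul_le_mul_of_nonneg_right ?_ (by positivity)
        refine Real.rpow_le_rpow_of_exponent_ge_of_imp (by positivity) ?_ hp fun _ h => ?_
        · rw [div_le_one (by positivity)]
          linarith
        · linarith
    _ = d * (d / r) / 2 := by
        rw [Real.rpow_two]
        field_simp
    _ ≤ d * (d / r) := half_le_self (by positivity)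

lemma tsum_ofReal_le {α : Type*} {S : Set α} {g : α → ℝ} (hg : ∀ x, 0 ≤ g x) {B : ℝ}
    (h : ∀ Y : Finset α, (∀ y ∈ Y, y ∈ S) → ∑ y ∈ Y, g y ≤ B) :
    ∑' x : S, ENNReal.ofReal (g x) ≤ ENNReal.ofReal B := by
  rw [ENNReal.tsum_eq_iSup_sum]
  refine iSup_le fun Y => ?_
  rw [← ENNReal.ofReal_sum_of_nonneg fun (x : S) _ => hg x]
  refine ENNReal.ofReal_le_ofReal ?_
  have := h (Y.map (Function.Embedding.subtype _)) (by simp +contextual)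
  simpa using this

lemma tsum_ofReal_le_ofReal {g : ℕ → ℝ} (hg : ∀ i, 0 ≤ g i) {B : ℝ}
    (h : ∀ N, ∑ i ∈ Finset.range N, g i ≤ B) :
    ∑' i, ENNReal.ofReal (g i) ≤ ENNReal.ofReal B := by
  refine ENNReal.tsum_le_of_sum_range_le fun N => ?_
  rw [← ENNReal.ofReal_sum_of_nonneg fun i _ => hg i]
  exact ENNReal.ofReal_le_ofReal (h N)

lemma betaSum_eq_zero_of_subsingleton {E : Set X} (hE : E.Subsingleton) {net : ℤ → Set X}
    (hnet : ∀ k, net k ⊆ E) {A p : ℝ} (hp : p ≠ 0) : betaSum E net A p = 0 := by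
  unfold betaSum
  refine ENNReal.tsum_eq_zero.2 fun k => ENNReal.tsum_eq_zero.2 fun x => ?_
  refine ENNReal.ofReal_eq_zero.2 (le_of_eq ?_)
  rcases subsingleton_or_nontrivial X with hX | hX
  · rw [diam_subsingleton (subsingleton_of_subsingleton), mul_zero]
  · have hEx : E ⊆ closedBall (x : X) 0 := fun y hy => by simp [hE hy (hnet k x.2)]
    have h := jonesBeta_le (E := E) (Q := closedBall (x : X) (A * (2 : ℝ) ^ (-k))) le_rfl
      (isNearLine_of_subset_closedBall (inter_subset_left.trans hEx))
    rw [zero_div] at h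
    rw [le_antisymm h (jonesBeta_nonneg _ _), Real.zero_rpow hp, zero_mul]

lemma tsum_int_eq_add (G : ℤ → ℝ≥0∞) (n : ℤ) :
    ∑' k, G k = ∑' i : ℕ, G (i - n) + ∑' i : ℕ, G (-(i + 1) - n) := by
  rw [← (Equiv.subRight n).tsum_eq G]
  exact tsum_of_nat_of_neg_add_one ENNReal.summable ENNReal.summable

/-- The part of the beta sum over scales larger than the diameter of the set. -/
lemma tsum_coarse_le [Nontrivial X] {E : Set X} {net : ℤ → Set X}
    (hnet : IsPartialMultiresolution E net) {A p d : ℝ} {n : ℤ} (hp : 2 ≤ p) (hA : 1 < A)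
    (hd : 0 < d) (hn : d < 2 ^ (n + 1)) (hE : ∀ x ∈ E, E ⊆ closedBall x d) :
    ∑' i : ℕ, ∑' x : net (-(i + 1) - n),
      ENNReal.ofReal (jonesBeta E (closedBall (x : X) (A * (2 : ℝ) ^ (-(-(i + 1) - n)))) ^ p *
        diam (closedBall (x : X) (A * (2 : ℝ) ^ (-(-(i + 1) - n))))) ≤
      ENNReal.ofReal (2 * d) := by
  have hscale : ∀ i : ℕ, d * 2 ^ i < (2 : ℝ) ^ (-(-(i + 1) - n)) := by
    intro i
    rw [show -(-((i : ℤ) + 1) - n) = (n + 1) + i by ring, zpow_add₀ two_ne_zero, zpow_natCast]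
    exact mul_lt_mul_of_pos_right hn (by positivity)
  have hscale' : ∀ i : ℕ, d < (2 : ℝ) ^ (-(-(i + 1) - n)) := fun i =>
    (le_mul_of_one_le_right hd.le (one_le_pow₀ one_le_two)).trans_lt (hscale i)
  refine le_trans (ENNReal.tsum_le_tsum fun i => ?_)
    (tsum_ofReal_le_ofReal (g := fun i => d * (1 / 2) ^ i) (fun i => by positivity) fun N => ?_)
  · refine tsum_ofReal_le (g := fun x => jonesBeta E (closedBall x _) ^ p * diam (closedBall x _))
      (fun x => jonesBeta_rpow_mul_diam_nonneg _ _ _) fun Y hY => ?_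
    have hcard : Y.card ≤ 1 := by
      refine Finset.card_le_one.2 fun x hx y hy => ?_
      by_contra hne
      have h1 := hnet.2.2 _ x (hY x hx) y (hY y hy) hne
      have h2 := hE y (hnet.1 _ (hY y hy)) (hnet.1 _ (hY x hx))
      exact (hscale' i).not_ge (h1.trans (mem_closedBall.1 h2))
    have hterm : ∀ y ∈ Y, jonesBeta E (closedBall y (A * (2 : ℝ) ^ (-(-(i + 1) - n)))) ^ p *
        diam (closedBall y (A * (2 : ℝ) ^ (-(-(i + 1) - n)))) ≤ d * (1 / 2) ^ i := by
      intro y hy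
      have h1 : d * 2 ^ i ≤ A * (2 : ℝ) ^ (-(-(i + 1) - n)) :=
        (hscale i).le.trans (le_mul_of_one_le_left (by positivity) hA.le)
      refine (jonesBeta_rpow_mul_diam_le_of_subset_closedBall hp hd.le (by positivity) ?_
        (hE y (hnet.1 _ (hY y hy)))).trans ?_
      · exact (le_mul_of_one_le_right hd.le (one_le_pow₀ one_le_two)).trans h1
      · refine mul_le_mul_of_nonneg_left ?_ hd.le
        rw [div_le_iff₀ (by positivity), one_div, inv_pow, ← div_eq_inv_mul,
          le_div_iff₀ (by positivity)]
        exact h1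
    refine (Finset.sum_le_card_nsmul _ _ _ hterm).trans ?_
    rw [nsmul_eq_mul]
    exact mul_le_of_le_one_left (by positivity) (by exact_mod_cast hcard)
  · rw [← Finset.mul_sum, mul_comm]
    refine mul_le_mul_of_nonneg_right ?_ hd.le
    simpa using (summable_geometric_two.sum_le_tsum (Finset.range N)
      fun i _ => by positivity).trans_eq tsum_geometric_two

/-- The part of the beta sum over scales smaller than the diameter of the set. -/
lemma tsum_fine_le [Nontrivial X] {p cv η : ℝ} (hp : 2 ≤ p) (hcv : 0 < cv)
    (huc : ∀ x y : X, ‖x‖ ≤ 1 → ‖y‖ ≤ 1 →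
      ‖(2⁻¹ : ℝ) • (x + y)‖ ≤ 1 - cv * ‖x - y‖ ^ p)
    (hη0 : 0 < η) (hη1 : η * 6 ^ (p - 1) * 100 ^ p ≤ 2 * cv) (hη2 : η ≤ 1 / (100 * 2 ^ 15))
    {F : ℝ → X} {K : ℝ≥0} (hF : LipschitzWith K F) {E : Set X} {net : ℤ → Set X}
    (hnet : IsPartialMultiresolution E net) {A d : ℝ} {m : ℕ} {n : ℤ} (hA : 1 < A)
    (hm : 128 * A ≤ 2 ^ m) (hn : 2 ^ n ≤ d) (hEF : E ⊆ F '' Icc 0 1)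
    (hE0 : ∀ x ∈ E, 2 * A * d ≤ dist x (F 0)) (hE1 : ∀ x ∈ E, 2 * A * d ≤ dist x (F 1)) :
    ∑' i : ℕ, ∑' x : net (i - n),
      ENNReal.ofReal (jonesBeta E (closedBall (x : X) (A * (2 : ℝ) ^ (-((i : ℤ) - n)))) ^ p *
        diam (closedBall (x : X) (A * (2 : ℝ) ^ (-((i : ℤ) - n))))) ≤
      ENNReal.ofReal (A * (112 * (15 + 58 * (1 / η + 2 ^ 20)) + 8 * m) * K) := by
  have hA0 : 0 < A := by linarith
  have hr : 0 < A * (2 : ℝ) ^ n := by positivity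
  have hscale : ∀ i : ℕ, (2 : ℝ) ^ (-((i : ℤ) - n)) = 2 ^ n / 2 ^ i := by
    intro i
    rw [neg_sub, zpow_sub₀ two_ne_zero, zpow_natCast]
  refine le_trans (ENNReal.tsum_le_tsum fun i => ?_) (tsum_ofReal_le_ofReal
    (g := fun i => separatedBound F p A m (A * 2 ^ n / 2 ^ i))
    (fun i => separatedBound_nonneg hF (by linarith) hA hm (by positivity))
    (sum_separatedBound_le hp hcv huc hη0 hη1 hη2 hF m hA hr))
  refine tsum_ofReal_le (g := fun x => jonesBeta E (closedBall x _) ^ p * diam (closedBall x _))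
    (fun x => jonesBeta_rpow_mul_diam_nonneg _ _ _) fun Y hY => ?_
  rw [hscale, ← mul_div_assoc]
  refine (Finset.sum_le_sum fun y _ => jonesBeta_rpow_mul_diam_le_bend hEF (by linarith) y
    (by positivity)).trans (sum_bend_le_separatedBound hF (by linarith) hA hm (by positivity)
      (fun y hy => ?_) fun y hy y' hy' hne => ?_)
  · have hy := hnet.1 _ (hY y hy)
    have h : 2 * (A * 2 ^ n / 2 ^ i) ≤ 2 * A * d := by
      rw [mul_assoc 2 A d]
      have : A * 2 ^ n / 2 ^ i ≤ A * 2 ^ n := div_le_self hr.le (one_le_pow₀ one_le_two)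
      have := mul_le_mul_of_nonneg_left hn hA0.le
      linarith
    exact ⟨hEF hy, h.trans (hE0 y hy), h.trans (hE1 y hy)⟩
  · have h := hnet.2.2 _ y (hY y hy) y' (hY y' hy') hne
    rw [hscale] at h
    convert h using 1
    field_simp

end BetaSum

/-- Theorem 1.3(i): necessary condition in uniformly convex Banach spaces of power
type `p` with convexity constant `cv`. -/
theorem statement4 (p cv A : ℝ) (hp : 2 ≤ p) (hcv : 0 < cv) (hA : 1 < A) :
    ∃ C : ℝ, 0 < C ∧
      ∀ (X : Type u) [NormedAddCommGroup X] [NormedSpace ℝ X] [CompleteSpace X]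
        [MeasurableSpace X] [BorelSpace X],
        (∀ x y : X, ‖x‖ ≤ 1 → ‖y‖ ≤ 1 →
          ‖(2⁻¹ : ℝ) • (x + y)‖ ≤ 1 - cv * ‖x - y‖ ^ p) →
        ∀ (Γ E : Set X) (net : ℤ → Set X),
          IsRectifiableCurve Γ → E.Nonempty → E ⊆ Γ → IsPartialMultiresolution E net →
          SEp E net A p ≤ ENNReal.ofReal C * μH[1] Γ := by
  obtain ⟨m, hm⟩ := pow_unbounded_of_one_lt (128 * A) one_lt_two
  obtain ⟨η, hη0, hη1, hη2⟩ : ∃ η : ℝ, 0 < η ∧ η * 6 ^ (p - 1) * 100 ^ p ≤ 2 * cv ∧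
      η ≤ 1 / (100 * 2 ^ 15) := by
    refine ⟨min (2 * cv / (6 ^ (p - 1) * 100 ^ p)) (1 / (100 * 2 ^ 15)), by positivity, ?_,
      min_le_right _ _⟩
    rw [mul_assoc, ← le_div_iff₀ (by positivity)]
    exact min_le_left _ _
  have hA0 : 0 < A := by linarith
  set M : ℝ := A * (112 * (15 + 58 * (1 / η + 2 ^ 20)) + 8 * m) with hM
  have hM0 : 0 < M := by positivity
  refine ⟨24 + M * (72 + 96 * A), by positivity, ?_⟩
  intro X _ _ _ _ _ huc Γ E net ⟨⟨f₀, hf₀, hΓf₀⟩, hfin⟩ _ hEΓ hnet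
  have hcpt : IsCompact Γ := hΓf₀ ▸ isCompact_Icc.image_of_continuousOn hf₀
  have hconn : IsPreconnected Γ := hΓf₀ ▸ isPreconnected_Icc.image f₀ hf₀
  unfold SEp
  rcases Γ.subsingleton_or_nontrivial with hsub | hnt
  · rw [diam_subsingleton (hsub.anti hEΓ),
      betaSum_eq_zero_of_subsingleton (hsub.anti hEΓ) hnet.1 (by linarith)]
    simp
  obtain ⟨x₀, hx₀, y₀, hy₀, hne⟩ := id hnt
  have : Nontrivial X := ⟨x₀, y₀, hne⟩
  obtain ⟨f, hf, hlip⟩ := exists_lipschitz_parametrization hconn hcpt hnt hfin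
  set h := (μH[1] Γ).toReal with hh
  have h0 : 0 ≤ h := ENNReal.toReal_nonneg
  have hd0 : 0 < diam Γ :=
    (dist_pos.2 hne).trans_le (dist_le_diam_of_mem hcpt.isBounded hx₀ hy₀)
  have hdh : diam Γ ≤ 8 * h := by
    refine diam_le_of_forall_dist_le (by positivity) fun x hx y hy => ?_
    rw [← hf] at hx hy
    obtain ⟨s, hs, rfl⟩ := hx
    obtain ⟨t, ht, rfl⟩ := hy
    refine (hlip s hs t ht).trans (mul_le_of_le_one_right (by positivity) ?_)
    rw [abs_le]
    constructor <;> linarith [hs.1, hs.2, ht.1, ht.2]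
  obtain ⟨F, hF, hΓF, hends⟩ := exists_extended_path (D := (2 * A + 1) * diam Γ) hcpt.isBounded
    (by positivity) (by positivity) hf hlip
  obtain ⟨n, hn, hn'⟩ := exists_mem_Ico_zpow hd0 one_lt_two
  have hfine := tsum_fine_le hp hcv huc hη0 hη1 hη2 hF hnet hA hm.le hn (hEΓ.trans hΓF)
    (fun x hx => by linarith [(hends x (hEΓ hx)).1]) (fun x hx => by linarith [(hends x (hEΓ hx)).2])
  have hcoarse := tsum_coarse_le hnet hp hA hd0 hn' fun x hx y hy =>
    mem_closedBall.2 (dist_le_diam_of_mem hcpt.isBounded (hEΓ hy) (hEΓ hx))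
  rw [Real.coe_toNNReal _ (by positivity)] at hfine
  have hsum : diam Γ + (M * (3 * (8 * h) + 6 * ((2 * A + 1) * diam Γ)) + 2 * diam Γ) ≤
      (24 + M * (72 + 96 * A)) * h := by
    have h1 := mul_le_mul_of_nonneg_left hdh (by positivity : 0 ≤ M * (6 * (2 * A + 1)))
    linarith
  calc ENNReal.ofReal (diam E) + betaSum E net A p
      ≤ ENNReal.ofReal (diam Γ) +
        (ENNReal.ofReal (M * (3 * (8 * h) + 6 * ((2 * A + 1) * diam Γ))) +
          ENNReal.ofReal (2 * diam Γ)) := by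
        unfold betaSum
        rw [tsum_int_eq_add _ n]
        exact add_le_add (ENNReal.ofReal_le_ofReal (diam_mono hEΓ hcpt.isBounded))
          (add_le_add hfine hcoarse)
    _ = ENNReal.ofReal
        (diam Γ + (M * (3 * (8 * h) + 6 * ((2 * A + 1) * diam Γ)) + 2 * diam Γ)) := by
        rw [ENNReal.ofReal_add (by positivity) (by positivity),
          ENNReal.ofReal_add (by positivity) (by positivity)]
    _ ≤ ENNReal.ofReal ((24 + M * (72 + 96 * A)) * h) := ENNReal.ofReal_le_ofReal hsum
    _ = ENNReal.ofReal (24 + M * (72 + 96 * A)) * μH[1] Γ := by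
        rw [ENNReal.ofReal_mul (by positivity), hh, ENNReal.ofReal_toReal hfin.ne]

end
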